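/- arXiv:1911.01870 — 2 statements merged into one kernel-verified Lean document; each statement's English description precedes it below -/
import Mathlib

section
/- For every 𝔉/ℬ(H)-measurable ζ : Ω → H and every t ∈ [0,T] it holds (with ‖V‖_{L^q(ℙ;E)} = (E[‖V‖_E^q])^{1/q} ∈ [0,∞] and ∂_x X_{s,t}^v the Fréchet derivative of x ↦ X_{s,t}^x at v) that ‖𝕪_t − X_{0,t}^{ζ+O_0}‖_{L^p(ℙ;H)} ≤ ‖𝕆_t − O_t‖_{L^p(ℙ;H)} + ‖ξ − ζ‖_{L^p(ℙ;H)} + (C·max{T,1}/(1−δ−ι)) ∫_0^t ‖∂_x X_{s,t}^{𝕪_s − 𝕆_s + O_s + e^{sA}(ζ−ξ)}‖_{L^{2p}(ℙ;L(H))} · { |θ|_T^{γ−δ} ‖𝕗(𝕪_{⌊s⌋_θ})‖_{L^{2p}(ℙ;H_{γ−δ})} + ‖𝕗(𝕪_{⌊s⌋_θ}) − F(𝕪_{⌊s⌋_θ})‖_{L^{2p}(ℙ;H)} + ( |θ|_T^{1−δ} ‖𝕗(𝕪_{⌊s⌋_θ})‖_{L^{4p}(ℙ;H)} + |θ|_T^{ι}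 sup_{u∈[0,T]} ‖𝕗(𝕪_u)‖_{L^{4p}(ℙ;H)} + ‖𝕆_s − 𝕆_{⌊s⌋_θ}‖_{L^{4p}(ℙ;H_δ)} + |θ|_T^{γ−δ} ‖ξ‖_{L^{4p}(ℙ;H_γ)} + ‖𝕆_s − O_s‖_{L^{4p}(ℙ;H_δ)} + ‖ξ − ζ‖_{L^{4p}(ℙ;H_δ)} ) · ( 1 + ‖𝕪_{⌊s⌋_θ}‖_{L^{4pc}(ℙ;H_κ)} + ‖𝕪_s‖_{L^{4pc}(ℙ;H_κ)} + ‖𝕆_s − O_s‖_{L^{4pc}(ℙ;H_κ)} + ‖ξ − ζ‖_{L^{4pc}(ℙ;H_κ)} )^c } ds. -/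
open MeasureTheory Set
open scoped ENNReal RealInnerProductSpace NNReal

section Flow

open Filter Topology Metric

variable {V : Type*} [NormedAddCommGroup V] [NormedSpace ℝ V]

lemma IsIntegralCurveOn.hasDerivWithinAt_Ici {z : ℝ → V} {G : ℝ → V → V} {a b : ℝ}
    (hz : IsIntegralCurveOn z G (Icc a b)) {t : ℝ} (ht : t ∈ Ico a b) :
    HasDerivWithinAt z (G t (z t)) (Ici t) t :=
  (hz t (Ico_subset_Icc_self ht)).mono_of_mem_nhdsWithin (Icc_mem_nhdsGE_of_mem ht)

/-- If a continuous function starts below `ρ`, and it is below `ρ` at `r` whenever it is so on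
`[a, r)`, then it stays below `ρ`. -/
lemma ContinuousOn.forall_lt_of_bootstrap {e : ℝ → ℝ} {a b ρ : ℝ} (he : ContinuousOn e (Icc a b))
    (h : ∀ r ∈ Icc a b, (∀ u ∈ Ico a r, e u < ρ) → e r < ρ) : ∀ r ∈ Icc a b, e r < ρ := by
  by_contra! hcon
  have hcl : IsCompact {r ∈ Icc a b | ρ ≤ e r} := by
    refine isCompact_Icc.of_isClosed_subset ?_ (fun r hr => hr.1)
    exact he.preimage_isClosed_of_isClosed isClosed_Icc isClosed_Ici
  obtain ⟨r, hr, hmin⟩ := hcl.exists_isLeast (hcon.imp fun r hr => hr)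
  refine absurd hr.2 (not_le.2 (h r hr.1 fun u hu => ?_))
  by_contra! hu'
  exact absurd (hmin ⟨⟨hu.1, hu.2.le.trans hr.1.2⟩, hu'⟩) (not_le.2 hu.2)

/-- Two integral curves stay exponentially close when the vector field is Lipschitz on a ball that
contains a tube around one of them. -/
lemma IsIntegralCurveOn.dist_le_of_tube {z w : ℝ → V} {G : ℝ → V → V} {a b R : ℝ} {K : ℝ≥0}
    (hG : ∀ u ∈ Icc a b, LipschitzOnWith K (G u) (closedBall 0 (R + 1)))
    (hz : IsIntegralCurveOn z G (Icc a b)) (hw : IsIntegralCurveOn w G (Icc a b))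
    (hzR : ∀ u ∈ Icc a b, ‖z u‖ ≤ R)
    (hd : dist (w a) (z a) * Real.exp (K * (b - a)) < 1) :
    ∀ r ∈ Icc a b, dist (w r) (z r) ≤ dist (w a) (z a) * Real.exp (K * (r - a)) := by
  have key : ∀ r ∈ Icc a b, (∀ u ∈ Ico a r, dist (w u) (z u) < 1) →
      dist (w r) (z r) ≤ dist (w a) (z a) * Real.exp (K * (r - a)) := by
    intro r hr hu
    have hsub : Icc a r ⊆ Icc a b := Icc_subset_Icc le_rfl hr.2
    refine dist_le_of_trajectories_ODE_of_mem (v := G) (s := fun _ => closedBall 0 (R + 1))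
      (fun u hu => hG u (hsub (Ico_subset_Icc_self hu)))
      ((hw.mono hsub).continuousOn) (fun u hu => (hw.mono hsub).hasDerivWithinAt_Ici hu)
      (fun u hu' => ?_) ((hz.mono hsub).continuousOn)
      (fun u hu => (hz.mono hsub).hasDerivWithinAt_Ici hu)
      (fun u hu' => ?_) le_rfl r ⟨hr.1, le_rfl⟩
    · have h1 := hzR u (hsub (Ico_subset_Icc_self hu'))
      have h2 := hu u hu'
      rw [dist_eq_norm] at h2
      rw [mem_closedBall_zero_iff]
      calc ‖w u‖ = ‖z u + (w u - z u)‖ := by abel_nf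
        _ ≤ ‖z u‖ + ‖w u - z u‖ := norm_add_le _ _
        _ ≤ R + 1 := by linarith
    · have h1 := hzR u (hsub (Ico_subset_Icc_self hu'))
      rw [mem_closedBall_zero_iff]
      linarith
  have hlt : ∀ r ∈ Icc a b, dist (w r) (z r) < 1 := by
    refine ContinuousOn.forall_lt_of_bootstrap (continuous_dist.comp_continuousOn
      (hw.continuousOn.prodMk hz.continuousOn)) ?_
    intro r hr hu
    refine (key r hr hu).trans_lt (lt_of_le_of_lt ?_ hd)
    gcongr
    exact hr.2
  exact fun r hr => key r hr fun u hu => hlt u ⟨hu.1, hu.2.le.trans hr.2⟩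

/-- First order expansion of an integral curve for a vector field that is close to `g`. -/
lemma IsIntegralCurveOn.norm_sub_sub_smul_le {w : ℝ → V} {G : ℝ → V → V} {a b ρ ε : ℝ} {p g : V}
    (hab : a ≤ b) (hρ : 0 < ρ) (hw : IsIntegralCurveOn w G (Icc a b)) (hp : dist (w a) p < ρ)
    (hG : ∀ u ∈ Icc a b, ∀ x ∈ ball p (2 * ρ), ‖G u x - g‖ ≤ ε) (hlt : (‖g‖ + ε) * (b - a) < ρ) :
    ‖w b - w a - (b - a) • g‖ ≤ ε * (b - a) := by
  have hε : 0 ≤ ε := (norm_nonneg _).trans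
    (hG a ⟨le_rfl, hab⟩ p (mem_ball_self (by linarith)))
  have hcont := hw.continuousOn
  have hball : ∀ r ∈ Icc a b, dist (w r) (w a) < ρ := by
    refine ContinuousOn.forall_lt_of_bootstrap (continuous_dist.comp_continuousOn
      (hcont.prodMk continuousOn_const)) ?_
    intro r hr hu
    have hsub : Icc a r ⊆ Icc a b := Icc_subset_Icc le_rfl hr.2
    have := norm_image_sub_le_of_norm_deriv_right_le_segment (C := ‖g‖ + ε)
      (hcont.mono hsub) (fun u hu => (hw.mono hsub).hasDerivWithinAt_Ici hu) (fun u hu' => ?_) r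
      ⟨hr.1, le_rfl⟩
    · rw [dist_eq_norm]
      refine this.trans_lt (lt_of_le_of_lt ?_ hlt)
      gcongr
      exact hr.2
    · have h1 := hG u (hsub (Ico_subset_Icc_self hu')) (w u) (by
        rw [mem_ball]
        linarith [dist_triangle (w u) (w a) p, hu u hu'])
      calc ‖G u (w u)‖ = ‖g + (G u (w u) - g)‖ := by abel_nf
        _ ≤ ‖g‖ + ‖G u (w u) - g‖ := norm_add_le _ _
        _ ≤ _ := by linarith
  have h := norm_image_sub_le_of_norm_deriv_right_le_segment (C := ε)
    (f := fun u => w u - u • g) (f' := fun u => G u (w u) - g) (a := a) (b := b)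
    (hcont.sub (by fun_prop)) (fun u hu => (hw.hasDerivWithinAt_Ici hu).sub (by
      simpa using (hasDerivWithinAt_id u _).smul_const g)) (fun u hu => ?_) b ⟨hab, le_rfl⟩
  · convert h using 2
    rw [sub_smul]; abel
  · refine hG u (Ico_subset_Icc_self hu) (w u) ?_
    rw [mem_ball]
    linarith [dist_triangle (w u) (w a) p, hball u (Ico_subset_Icc_self hu)]

lemma gronwallBound_zero_mul (K c ε x : ℝ) :
    gronwallBound 0 K (c * ε) x = c * gronwallBound 0 K ε x := by
  unfold gronwallBound
  split_ifs <;> ring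

variable [ProperSpace V] {G : ℝ → V → V}

/-- A vector field with continuous derivative is Lipschitz on balls, uniformly on compact time
intervals. -/
lemma exists_lipschitzOnWith_closedBall (hd : ∀ u, Differentiable ℝ (G u))
    (hG' : Continuous fun q : ℝ × V => fderiv ℝ (G q.1) q.2) (a b R : ℝ) :
    ∃ K : ℝ≥0, ∀ u ∈ Icc a b, LipschitzOnWith K (G u) (closedBall 0 R) := by
  obtain ⟨K, hK⟩ := ((isCompact_Icc (a := a) (b := b)).prod
    (isCompact_closedBall (0 : V) R)).exists_bound_of_continuousOn hG'.continuousOn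
  refine ⟨K.toNNReal, fun u hu => (convex_closedBall _ _).lipschitzOnWith_of_nnnorm_fderiv_le
    (fun x _ => hd u x) fun x hx => ?_⟩
  rw [← NNReal.coe_le_coe, coe_nnnorm]
  exact (hK (u, x) ⟨hu, hx⟩).trans (Real.le_coe_toNNReal K)

/-- The solution of an ordinary differential equation depends differentiably on the initial value
over a time interval that is short compared to the linearization. -/
lemma differentiableAt_integralCurve_of_short {w : V → ℝ → V} {a b m : ℝ} {v : V} (hab : a ≤ b)
    (hG : ∀ u, Differentiable ℝ (G u))
    (hG' : Continuous fun q : ℝ × V => fderiv ℝ (G q.1) q.2)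
    (hw : ∀ x, IsIntegralCurveOn (w x) G (Icc a b)) (hwa : ∀ x, w x a = x) (hm : 0 ≤ m)
    (hbound : ∀ u ∈ Icc a b, ‖fderiv ℝ (G u) (w v u)‖ ≤ m) (hshort : 2 * m * (b - a) ≤ 1) :
    DifferentiableAt ℝ (fun x => w x b) v := by
  set z := w v with hz
  have hzc : ContinuousOn z (Icc a b) := (hw v).continuousOn
  set M : ℝ → V →L[ℝ] V := fun u => fderiv ℝ (G u) (z u) with hM
  have hMc : ContinuousOn M (Icc a b) :=
    hG'.comp_continuousOn (continuousOn_id.prodMk hzc)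
  have hpl : IsPicardLindelof (fun u (D : V →L[ℝ] V) => (M u).comp D)
      (⟨a, le_rfl, hab⟩ : Icc a b) (ContinuousLinearMap.id ℝ V) 1 0 (2 * m.toNNReal)
      m.toNNReal := by
    refine ⟨fun u hu => ?_, fun D _ => ?_, fun u hu D hD => ?_, ?_⟩
    · refine LipschitzOnWith.of_dist_le_mul fun D _ D' _ => ?_
      rw [dist_eq_norm, dist_eq_norm, ← ContinuousLinearMap.comp_sub, Real.coe_toNNReal _ hm]
      exact (ContinuousLinearMap.opNorm_comp_le _ _).trans (by gcongr; exact hbound u hu)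
    · exact hMc.clm_comp continuousOn_const
    · have h1 : ‖D‖ ≤ 2 := by
        rw [mem_closedBall, dist_eq_norm] at hD
        have := norm_le_norm_add_norm_sub' D (ContinuousLinearMap.id ℝ V)
        have h2 : ‖ContinuousLinearMap.id ℝ V‖ ≤ 1 := ContinuousLinearMap.norm_id_le
        simp only [NNReal.coe_one] at hD
        linarith
      push_cast
      rw [Real.coe_toNNReal _ hm]
      calc _ ≤ ‖M u‖ * ‖D‖ := ContinuousLinearMap.opNorm_comp_le _ _
        _ ≤ m * 2 := by gcongr; exact hbound u hu
        _ = _ := by ring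
    · push_cast
      rw [Real.coe_toNNReal _ hm, sub_self, max_eq_left (by linarith)]
      simpa using hshort
  obtain ⟨D, hDa, hD⟩ := hpl.exists_eq_forall_mem_Icc_hasDerivWithinAt₀
  simp only at hDa
  obtain ⟨R, hR⟩ := isCompact_Icc.exists_bound_of_continuousOn hzc
  obtain ⟨K, hK⟩ := exists_lipschitzOnWith_closedBall hG hG' a b (R + 1)
  refine HasFDerivAt.differentiableAt (f' := D b) ?_
  rw [hasFDerivAt_iff_isLittleO, Asymptotics.isLittleO_iff]
  intro ε hε
  obtain ⟨η, hη, hηε⟩ : ∃ η : ℝ, 0 < η ∧ gronwallBound 0 m η (b - a) < ε := by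
    have h1 := (gronwallBound_continuous_ε 0 m (b - a)).tendsto 0
    rw [gronwallBound_ε0_δ0] at h1
    have h2 : ∀ᶠ η in 𝓝[>] (0 : ℝ), gronwallBound 0 m η (b - a) < ε :=
      (h1.mono_left nhdsWithin_le_nhds).eventually (gt_mem_nhds hε)
    obtain ⟨η, h3, h4⟩ := (h2.and self_mem_nhdsWithin).exists
    exact ⟨η, h4, h3⟩
  set κ := Real.exp (K * (b - a)) with hκ
  have hκ0 : 0 < κ := Real.exp_pos _
  have huc := ((isCompact_Icc (a := a) (b := b)).prod
    (isCompact_closedBall (0 : V) (R + 1))).uniformContinuousOn_of_continuous hG'.continuousOn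
  rw [Metric.uniformContinuousOn_iff] at huc
  obtain ⟨ρ, hρ, hρ'⟩ := huc (η / κ) (by positivity)
  have hnear : ∀ᶠ x in 𝓝 v, dist x v * κ < min ρ 1 := by
    have : Tendsto (fun x => dist x v * κ) (𝓝 v) (𝓝 (dist v v * κ)) :=
      Continuous.tendsto (by fun_prop) v
    rw [dist_self, zero_mul] at this
    exact this.eventually (gt_mem_nhds (by positivity))
  filter_upwards [hnear] with x hx
  have htube := IsIntegralCurveOn.dist_le_of_tube hK (hw v) (hw x) hR (by
    rw [hwa, hwa]; exact hx.trans_le (min_le_right _ _))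
  have hdist : ∀ u ∈ Icc a b, dist (w x u) (z u) ≤ ‖x - v‖ * κ := by
    intro u hu
    refine (htube u hu).trans ?_
    rw [hwa, hwa, dist_eq_norm, hκ]
    gcongr
    exact hu.2
  have hrem : ∀ u ∈ Icc a b,
      ‖G u (w x u) - G u (z u) - M u (w x u - z u)‖ ≤ ‖x - v‖ * η := by
    intro u hu
    have hd1 := hdist u hu
    rw [← dist_eq_norm] at hd1
    have hdρ : dist (w x u) (z u) < min ρ 1 := hd1.trans_lt hx
    have h := (convex_closedBall (z u) (dist (w x u) (z u))).norm_image_sub_le_of_norm_fderiv_le'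
      (f := G u) (φ := M u) (C := η / κ) (fun q _ => hG u q) (fun q hq => ?_)
      (mem_closedBall_self dist_nonneg) (mem_closedBall.2 le_rfl)
    · refine h.trans ?_
      rw [← dist_eq_norm]
      calc η / κ * dist (w x u) (z u) ≤ η / κ * (dist x v * κ) := by gcongr
        _ = ‖x - v‖ * η := by rw [dist_eq_norm]; field_simp
    · have hq1 : dist q (z u) < min ρ 1 := (mem_closedBall.1 hq).trans_lt hdρ
      have hzu := hR u hu
      refine le_of_lt ?_
      rw [← dist_eq_norm]
      refine hρ' (u, q) ⟨hu, ?_⟩ (u, z u) ⟨hu, ?_⟩ ?_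
      · have := hq1.trans_le (min_le_right _ _)
        rw [dist_eq_norm] at this
        rw [mem_closedBall_zero_iff]
        have := norm_le_norm_add_norm_sub' q (z u)
        linarith
      · rw [mem_closedBall_zero_iff]; linarith
      · rw [Prod.dist_eq]
        simpa [hρ] using hq1.trans_le (min_le_left _ _)
  have hgr := norm_le_gronwallBound_of_norm_deriv_right_le (δ := 0) (K := m) (ε := ‖x - v‖ * η)
    (f := fun u => w x u - z u - D u (x - v))
    (f' := fun u => G u (w x u) - G u (z u) - (M u) (D u (x - v))) (a := a) (b := b)
    (((hw x).continuousOn.sub hzc).sub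
      (ContinuousOn.clm_apply (fun u hu => (hD u hu).continuousWithinAt) continuousOn_const))
    (fun u hu => (((hw x).hasDerivWithinAt_Ici hu).sub ((hw v).hasDerivWithinAt_Ici hu)).sub ?_)
    (by simp [hwa, hz, hDa]) (fun u hu => ?_) b ⟨hab, le_rfl⟩
  · refine hgr.trans ?_
    rw [gronwallBound_zero_mul, mul_comm]
    gcongr
  · have := ((hD u (Ico_subset_Icc_self hu)).mono_of_mem_nhdsWithin (Icc_mem_nhdsGE_of_mem hu))
    simpa using this.clm_apply (hasDerivWithinAt_const u _ (x - v))
  · have hu' := Ico_subset_Icc_self hu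
    calc ‖G u (w x u) - G u (z u) - (M u) (D u (x - v))‖
        = ‖M u (w x u - z u - D u (x - v)) +
            (G u (w x u) - G u (z u) - M u (w x u - z u))‖ := by
          congr 1; simp only [map_sub]; abel
      _ ≤ ‖M u (w x u - z u - D u (x - v))‖ + ‖x - v‖ * η :=
          (norm_add_le _ _).trans (by gcongr; exact hrem u hu')
      _ ≤ _ := by
          gcongr
          exact (M u).le_of_opNorm_le (hbound u hu') _


/-- `W s r x` is the value at time `r` of an integral curve of `G` on `[s, T]` that is `x` at
time `s`. -/
structure IsForwardFlow (W : ℝ → ℝ → V → V) (G : ℝ → V → V) (T : ℝ) : Prop where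
  isIntegralCurveOn : ∀ s ∈ Icc 0 T, ∀ x, IsIntegralCurveOn (fun r => W s r x) G (Icc s T)
  apply_self : ∀ s ∈ Icc 0 T, ∀ x, W s s x = x

namespace IsForwardFlow

variable {W : ℝ → ℝ → V → V} {T : ℝ}

lemma comp_apply (h : IsForwardFlow W G T) (hd : ∀ u, Differentiable ℝ (G u))
    (hG' : Continuous fun q : ℝ × V => fderiv ℝ (G q.1) q.2) {s r t : ℝ} (hs : 0 ≤ s)
    (hsr : s ≤ r) (hrt : r ≤ t) (htT : t ≤ T) (x : V) : W r t (W s r x) = W s t x := by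
  have hcs := h.isIntegralCurveOn s ⟨hs, by linarith⟩ x
  have hcr := h.isIntegralCurveOn r ⟨by linarith, by linarith⟩ (W s r x)
  have hcs' := hcs.mono (Icc_subset_Icc_left (b := T) hsr)
  obtain ⟨R, hR⟩ := isCompact_Icc.exists_bound_of_continuousOn hcs'.continuousOn
  obtain ⟨K, hK⟩ := exists_lipschitzOnWith_closedBall hd hG' r T (R + 1)
  have hself := h.apply_self r ⟨by linarith, by linarith⟩ (W s r x)
  have := IsIntegralCurveOn.dist_le_of_tube hK hcs' hcr hR (by simp [hself]) t ⟨hrt, htT⟩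
  simpa [hself] using this

lemma differentiableAt (h : IsForwardFlow W G T) (hd : ∀ u, Differentiable ℝ (G u))
    (hG' : Continuous fun q : ℝ × V => fderiv ℝ (G q.1) q.2) {s t : ℝ} (hs : 0 ≤ s)
    (hst : s ≤ t) (htT : t ≤ T) (x : V) : DifferentiableAt ℝ (W s t) x := by
  have hcs := (h.isIntegralCurveOn s ⟨hs, by linarith⟩ x).mono (Icc_subset_Icc_right htT)
  obtain ⟨m, hm⟩ := isCompact_Icc.exists_bound_of_continuousOn
    (hG'.comp_continuousOn (continuousOn_id.prodMk hcs.continuousOn))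
  simp only [id] at hm
  have hm0 : 0 ≤ m := (norm_nonneg _).trans (hm s ⟨le_rfl, hst⟩)
  obtain ⟨N, hN⟩ := exists_nat_gt (2 * m * (t - s))
  have hN0 : (0 : ℝ) < N := lt_of_le_of_lt (by have := sub_nonneg.2 hst; positivity) hN
  have hstep : ∀ k : ℕ, k ≤ N → DifferentiableAt ℝ (W s (s + k * ((t - s) / N))) x := by
    intro k
    induction k with
    | zero =>
      intro _
      have : W s (s + (0 : ℕ) * ((t - s) / N)) = id := by
        ext y; simpa using h.apply_self s ⟨hs, by linarith⟩ y
      rw [this]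
      exact differentiableAt_id
    | succ k ih =>
      intro hk
      set τ := (t - s) / N with hτ
      have hτ0 : 0 ≤ τ := div_nonneg (sub_nonneg.2 hst) hN0.le
      have hkN : ((k + 1 : ℕ) : ℝ) * τ ≤ t - s := by
        calc ((k + 1 : ℕ) : ℝ) * τ ≤ N * τ := by gcongr
          _ = t - s := by rw [hτ]; field_simp
      set r := s + k * τ with hr
      set r' := s + (k + 1 : ℕ) * τ with hr'
      have hrr' : r' - r = τ := by rw [hr, hr']; push_cast; ring
      have hsr : s ≤ r := by rw [hr]; have : 0 ≤ k * τ := by positivity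
                             linarith
      have hr't : r' ≤ t := by rw [hr']; linarith
      have hle : r ≤ r' := by linarith
      have hfun : W s r' = (fun y => W r r' y) ∘ W s r := by
        ext y
        exact (h.comp_apply hd hG' hs hsr hle (hr't.trans htT) y).symm
      rw [hfun]
      refine DifferentiableAt.comp x ?_ (ih (by omega))
      refine differentiableAt_integralCurve_of_short (w := fun y u => W r u y) (m := m) hle hd hG'
        (fun y => (h.isIntegralCurveOn r ⟨by linarith, by linarith⟩ y).mono
          (Icc_subset_Icc_right (hr't.trans htT)))
        (fun y => h.apply_self r ⟨by linarith, by linarith⟩ y) hm0 (fun u hu => ?_) ?_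
      · rw [h.comp_apply hd hG' hs hsr hu.1 (hu.2.trans (hr't.trans htT))]
        exact hm u ⟨hsr.trans hu.1, hu.2.trans hr't⟩
      · rw [hrr', hτ, ← mul_div_assoc, div_le_one hN0]
        exact hN.le
  have := hstep N le_rfl
  rwa [mul_div_cancel₀ _ hN0.ne', add_sub_cancel] at this

/-- Left derivative of `s ↦ W s t (P s)`: the infinitesimal form of the Alekseev–Gröbner
formula. -/
lemma hasDerivWithinAt_comp (h : IsForwardFlow W G T) (hG : Continuous fun q : ℝ × V => G q.1 q.2)
    (hd : ∀ u, Differentiable ℝ (G u))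
    (hG' : Continuous fun q : ℝ × V => fderiv ℝ (G q.1) q.2) {P : ℝ → V} {p : V} {s t : ℝ}
    (hs : 0 < s) (hst : s ≤ t) (htT : t ≤ T) (hP : HasDerivWithinAt P p (Iic s) s) :
    HasDerivWithinAt (fun r => W r t (P r)) (fderiv ℝ (W s t) (P s) (p - G s (P s))) (Iic s) s := by
  have hself := h.apply_self s ⟨hs.le, by linarith⟩ (P s)
  have hQ : HasDerivWithinAt (fun r => W r s (P r) - P r) (-G s (P s)) (Iic s) s := by
    rw [hasDerivWithinAt_iff_isLittleO, Asymptotics.isLittleO_iff]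
    intro ε hε
    obtain ⟨ρ, hρ, hGρ⟩ := Metric.continuous_iff.1 hG (s, P s) ε hε
    have h1 : ∀ᶠ r in 𝓝[≤] s, dist (P r) (P s) < ρ / 2 :=
      hP.continuousWithinAt.tendsto.eventually (ball_mem_nhds _ (by positivity))
    have h2 : ∀ᶠ r in 𝓝[≤] s, (‖G s (P s)‖ + ε) * (s - r) < ρ / 2 ∧ s - r < ρ ∧ 0 < r := by
      refine nhdsWithin_le_nhds ?_
      have e1 : Tendsto (fun r => (‖G s (P s)‖ + ε) * (s - r)) (𝓝 s) (𝓝 0) := by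
        have : Continuous fun r => (‖G s (P s)‖ + ε) * (s - r) := by fun_prop
        simpa using this.tendsto s
      have e2 : Tendsto (fun r => s - r) (𝓝 s) (𝓝 0) := by
        have : Continuous fun r => s - r := by fun_prop
        simpa using this.tendsto s
      exact (e1.eventually (gt_mem_nhds (by positivity))).and
        ((e2.eventually (gt_mem_nhds hρ)).and (lt_mem_nhds hs))
    filter_upwards [h1, h2, self_mem_nhdsWithin] with r hr1 hr2 hr3
    have hr3 : r ≤ s := hr3
    have hrself := h.apply_self r ⟨hr2.2.2.le, by linarith⟩ (P r)
    have := IsIntegralCurveOn.norm_sub_sub_smul_le (w := fun u => W r u (P r)) (G := G) (b := s)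
      (p := P s) (g := G s (P s)) (ε := ε) hr3 (half_pos hρ)
      ((h.isIntegralCurveOn r ⟨hr2.2.2.le, by linarith⟩ (P r)).mono
        (Icc_subset_Icc_right (hst.trans htT))) (by simpa [hrself] using hr1) ?_ hr2.1
    · simp only [hrself] at this
      rw [hself, sub_self, sub_zero, smul_neg, sub_neg_eq_add, Real.norm_eq_abs,
        abs_of_nonpos (by linarith)]
      convert this using 2
      · rw [sub_smul, sub_smul]; abel
      · ring
    · intro u hu x hx
      rw [← dist_eq_norm]
      refine (hGρ (u, x) ?_).le
      rw [Prod.dist_eq, max_lt_iff]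
      refine ⟨?_, by simpa [mul_div_cancel₀] using hx⟩
      rw [Real.dist_eq, abs_lt]
      constructor <;> linarith [hu.1, hu.2, hr2.2.1]
  have hR : HasDerivWithinAt (fun r => W r s (P r)) (p - G s (P s)) (Iic s) s := by
    have := hQ.add hP
    rw [neg_add_eq_sub] at this
    refine this.congr_of_eventuallyEq (Eventually.of_forall fun r => ?_) ?_ <;> simp
  have hD : HasFDerivAt (W s t) (fderiv ℝ (W s t) (P s)) (W s s (P s)) := by
    rw [hself]
    exact (h.differentiableAt hd hG' hs.le hst htT (P s)).hasFDerivAt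
  refine (hD.comp_hasDerivWithinAt s hR).congr_of_eventuallyEq ?_ ?_
  · filter_upwards [self_mem_nhdsWithin, nhdsWithin_le_nhds (lt_mem_nhds hs)] with r hr hr0
    exact (h.comp_apply hd hG' hr0.le hr hst htT (P r)).symm
  · simp [hself]

lemma continuousOn_comp (h : IsForwardFlow W G T) (hG : Continuous fun q : ℝ × V => G q.1 q.2)
    (hd : ∀ u, Differentiable ℝ (G u))
    (hG' : Continuous fun q : ℝ × V => fderiv ℝ (G q.1) q.2) {P P' : ℝ → V} {t : ℝ}
    (htT : t ≤ T) (hPc : ContinuousOn P (Icc 0 t))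
    (hP : ∀ s ∈ Ioc 0 t, HasDerivWithinAt P (P' s) (Iic s) s) :
    ContinuousOn (fun r => W r t (P r)) (Icc 0 t) := by
  intro s hs
  have hleft : ContinuousWithinAt (fun r => W r t (P r)) (Icc 0 s) s := by
    rcases hs.1.eq_or_lt with rfl | hs0
    · simp
    · exact ((h.hasDerivWithinAt_comp hG hd hG' hs0 hs.2 htT
        (hP s ⟨hs0, hs.2⟩)).continuousWithinAt).mono Icc_subset_Iic_self
  have hright : ContinuousWithinAt (fun r => W r t (P r)) (Icc s t) s := by
    have hsT : s ∈ Icc 0 T := ⟨hs.1, hs.2.trans htT⟩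
    have hz := h.isIntegralCurveOn s hsT (P s)
    have hself := h.apply_self s hsT (P s)
    have hzc := hz.continuousOn
    obtain ⟨R, hR⟩ := isCompact_Icc.exists_bound_of_continuousOn hzc
    obtain ⟨K, hK⟩ := exists_lipschitzOnWith_closedBall hd hG' s T (R + 1)
    have hlim : Tendsto (fun r => dist (P r) (W s r (P s)) * Real.exp (K * (T - s)))
        (𝓝[Icc s t] s) (𝓝 0) := by
      have h1 : ContinuousWithinAt P (Icc s t) s :=
        (hPc s hs).mono (Icc_subset_Icc_left hs.1)
      have h2 : ContinuousWithinAt (fun r => W s r (P s)) (Icc s t) s :=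
        (hzc s ⟨le_rfl, hsT.2⟩).mono (Icc_subset_Icc_right htT)
      have h3 := (Tendsto.dist h1 h2).mul_const (Real.exp (K * (T - s)))
      simpa [hself] using h3
    rw [ContinuousWithinAt, tendsto_iff_dist_tendsto_zero]
    refine squeeze_zero' (Eventually.of_forall fun _ => dist_nonneg) ?_ hlim
    filter_upwards [hlim.eventually (gt_mem_nhds one_pos), self_mem_nhdsWithin] with r hr1 hr
    have hrT : r ∈ Icc 0 T := ⟨hs.1.trans hr.1, hr.2.trans htT⟩
    have hrself := h.apply_self r hrT (P r)
    have hexp : Real.exp (K * (T - r)) ≤ Real.exp (K * (T - s)) := by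
      gcongr; exact hr.1
    have := IsIntegralCurveOn.dist_le_of_tube (a := r)
      (fun u hu => hK u ⟨hr.1.trans hu.1, hu.2⟩) (hz.mono (Icc_subset_Icc_left hr.1))
      (h.isIntegralCurveOn r hrT (P r)) (fun u hu => hR u ⟨hr.1.trans hu.1, hu.2⟩)
      (by
        rw [hrself]
        exact lt_of_le_of_lt (by gcongr) hr1) t ⟨hr.2, htT⟩
    rw [hrself] at this
    refine this.trans ?_
    gcongr
    exact hr.1
  have := hleft.union hright
  rwa [Icc_union_Icc_eq_Icc hs.1 hs.2] at this

end IsForwardFlow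

end Flow

section Lp

open Filter Topology

/-- **Minkowski's integral inequality** for the Lebesgue integral. -/
lemma ENNReal.lintegral_lintegral_rpow_le {S Ω : Type*} [MeasurableSpace S] [MeasurableSpace Ω]
    {ν : Measure S} [SFinite ν] {μ : Measure Ω} [IsFiniteMeasure μ] {g : S → Ω → ℝ≥0∞}
    (hg : Measurable (Function.uncurry g)) {p : ℝ} (hp : 1 ≤ p) :
    (∫⁻ ω, (∫⁻ s, g s ω ∂ν) ^ p ∂μ) ^ (1 / p) ≤ ∫⁻ s, (∫⁻ ω, g s ω ^ p ∂μ) ^ (1 / p) ∂ν := by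
  rcases hp.eq_or_lt with rfl | hp1
  · simp only [ENNReal.rpow_one, one_div, inv_one]
    rw [lintegral_lintegral_swap]
    exact (hg.comp measurable_swap).aemeasurable
  have hp0 : 0 < p := by linarith
  set h : Ω → ℝ≥0∞ := fun ω => ∫⁻ s, g s ω ∂ν with hh
  have hhm : Measurable h := (hg.comp measurable_swap).lintegral_prod_right'
  set B := ∫⁻ s, (∫⁻ ω, g s ω ^ p ∂μ) ^ (1 / p) ∂ν with hB
  have hpq : (Real.conjExponent p).HolderConjugate p :=
    (Real.HolderConjugate.conjExponent hp1).symm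
  set q := Real.conjExponent p with hq
  have key : ∀ n : ℕ, ∫⁻ ω, min (h ω) n ^ p ∂μ ≤ B ^ p := by
    intro n
    set k : Ω → ℝ≥0∞ := fun ω => min (h ω) n with hk
    have hkm : Measurable k := hhm.min measurable_const
    set I := ∫⁻ ω, k ω ^ p ∂μ with hI
    have hItop : I ≠ ∞ := by
      refine ne_top_of_le_ne_top (b := (n : ℝ≥0∞) ^ p * μ univ) ?_ ?_
      · exact ENNReal.mul_ne_top (ENNReal.rpow_ne_top_of_nonneg hp0.le (by simp))
          (measure_ne_top _ _)
      · rw [← lintegral_const]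
        exact lintegral_mono fun ω => ENNReal.rpow_le_rpow (min_le_right _ _) hp0.le
    have hstep : I ≤ I ^ (1 / q) * B := by
      calc I ≤ ∫⁻ ω, k ω ^ (p - 1) * h ω ∂μ := by
            refine lintegral_mono fun ω => ?_
            have hktop : k ω ≠ ∞ := ne_top_of_le_ne_top (by simp) (min_le_right (h ω) (n : ℝ≥0∞))
            calc k ω ^ p = k ω ^ ((p - 1) + 1) := by rw [sub_add_cancel]
              _ = k ω ^ (p - 1) * k ω := by
                rw [ENNReal.rpow_add_of_nonneg _ _ (by linarith) zero_le_one, ENNReal.rpow_one]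
              _ ≤ _ := by gcongr; exact min_le_left _ _
        _ = ∫⁻ ω, ∫⁻ s, k ω ^ (p - 1) * g s ω ∂ν ∂μ := by
            refine lintegral_congr fun ω => ?_
            rw [lintegral_const_mul]
            exact hg.comp measurable_prodMk_right
        _ = ∫⁻ s, ∫⁻ ω, k ω ^ (p - 1) * g s ω ∂μ ∂ν := by
            refine lintegral_lintegral_swap (Measurable.aemeasurable ?_)
            exact ((hkm.comp measurable_fst).pow_const _).mul (hg.comp measurable_swap)
        _ ≤ ∫⁻ s, I ^ (1 / q) * (∫⁻ ω, g s ω ^ p ∂μ) ^ (1 / p) ∂ν := by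
            refine lintegral_mono fun s => ?_
            refine (ENNReal.lintegral_mul_le_Lp_mul_Lq μ hpq (hkm.pow_const _).aemeasurable
              (hg.comp measurable_prodMk_left).aemeasurable).trans (le_of_eq ?_)
            congr 2
            refine lintegral_congr fun ω => ?_
            rw [← ENNReal.rpow_mul, hpq.symm.sub_one_mul_conj]
        _ = I ^ (1 / q) * B := by
            rw [lintegral_const_mul]
            exact ((hg.pow_const p).lintegral_prod_right').pow_const _
    rcases eq_or_ne I 0 with hI0 | hI0
    · rw [hI0]; exact zero_le
    have hq0 : 0 < 1 / q := one_div_pos.2 hpq.pos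
    have hfin : I ^ (1 / q) ≠ ∞ := ENNReal.rpow_ne_top_of_nonneg hq0.le hItop
    have hpos : I ^ (1 / q) ≠ 0 := by simp [hI0, hItop]
    have hsum : 1 / q + 1 / p = 1 := by simpa using hpq.inv_add_inv_eq_one
    have hle : I ^ (1 / p) ≤ B := by
      refine (ENNReal.mul_le_mul_iff_right hpos hfin).1 ?_
      rw [← ENNReal.rpow_add _ _ hI0 hItop, hsum, ENNReal.rpow_one]
      exact hstep
    calc I = (I ^ (1 / p)) ^ p := by
          rw [← ENNReal.rpow_mul, one_div_mul_cancel hp0.ne', ENNReal.rpow_one]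
      _ ≤ B ^ p := ENNReal.rpow_le_rpow hle hp0.le
  have hlim : ∀ ω, Tendsto (fun n : ℕ => min (h ω) (n : ℝ≥0∞) ^ p) atTop (𝓝 (h ω ^ p)) := by
    intro ω
    refine (ENNReal.continuous_rpow_const.tendsto _).comp ?_
    have : Tendsto (fun n : ℕ => min (h ω) (n : ℝ≥0∞)) atTop (𝓝 (min (h ω) ∞)) :=
      tendsto_const_nhds.min ENNReal.tendsto_nat_nhds_top
    simpa using this
  have hfinal : ∫⁻ ω, h ω ^ p ∂μ ≤ B ^ p := by
    calc ∫⁻ ω, h ω ^ p ∂μ = ∫⁻ ω, liminf (fun n : ℕ => min (h ω) (n : ℝ≥0∞) ^ p) atTop ∂μ :=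
          lintegral_congr fun ω => (hlim ω).liminf_eq.symm
      _ ≤ liminf (fun n : ℕ => ∫⁻ ω, min (h ω) (n : ℝ≥0∞) ^ p ∂μ) atTop :=
          lintegral_liminf_le fun n => (hhm.min measurable_const).pow_const _
      _ ≤ B ^ p := by
          refine liminf_le_of_le (by isBoundedDefault) fun b hb => ?_
          obtain ⟨n, hn⟩ := hb.exists
          exact hn.trans (key n)
  calc (∫⁻ ω, h ω ^ p ∂μ) ^ (1 / p) ≤ (B ^ p) ^ (1 / p) :=
        ENNReal.rpow_le_rpow hfinal (by positivity)
    _ = B := by rw [← ENNReal.rpow_mul, mul_one_div_cancel hp0.ne', ENNReal.rpow_one]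

lemma eLpNorm_ofReal_eq {Ω V : Type*} [MeasurableSpace Ω] {μ : Measure Ω} [NormedAddCommGroup V]
    (f : Ω → V) {p : ℝ} (hp : 0 < p) :
    eLpNorm f (ENNReal.ofReal p) μ = (∫⁻ ω, ‖f ω‖ₑ ^ p ∂μ) ^ (1 / p) := by
  rw [eLpNorm_eq_lintegral_rpow_enorm_toReal (by simpa using hp) ENNReal.ofReal_ne_top,
    ENNReal.toReal_ofReal hp.le]

/-- Minkowski's integral inequality for a random variable that is pointwise dominated by an
integral. -/
lemma eLpNorm_le_lintegral_eLpNorm {S Ω V V' : Type*} [MeasurableSpace S] [MeasurableSpace Ω]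
    [NormedAddCommGroup V] [NormedAddCommGroup V'] {ν : Measure S} [SFinite ν] {μ : Measure Ω}
    [IsFiniteMeasure μ] {g : S → Ω → V'} {f : Ω → V}
    (hg : Measurable fun q : S × Ω => ‖g q.1 q.2‖ₑ)
    (hfg : ∀ ω, ‖f ω‖ₑ ≤ ∫⁻ s, ‖g s ω‖ₑ ∂ν) {p : ℝ} (hp : 1 ≤ p) :
    eLpNorm f (ENNReal.ofReal p) μ ≤ ∫⁻ s, eLpNorm (g s) (ENNReal.ofReal p) μ ∂ν := by
  have hp0 : 0 < p := by linarith
  simp only [eLpNorm_ofReal_eq _ hp0]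
  refine le_trans ?_ (ENNReal.lintegral_lintegral_rpow_le (g := fun s ω => ‖g s ω‖ₑ) hg hp)
  gcongr with ω
  exact hfg ω

variable {V : Type*} [NormedAddCommGroup V] [NormedSpace ℝ V]

/-- A continuous function grows at most by the integral of the norm of its left derivative. -/
lemma enorm_sub_le_lintegral_of_hasDerivWithinAt_Iic [CompleteSpace V] {φ φ' : ℝ → V} {t : ℝ}
    (ht : 0 ≤ t) (hc : ContinuousOn φ (Icc 0 t))
    (hd : ∀ s ∈ Ioc 0 t, HasDerivWithinAt φ (φ' s) (Iic s) s)
    (hm : AEStronglyMeasurable φ' (volume.restrict (Ioc 0 t))) :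
    ‖φ t - φ 0‖ₑ ≤ ∫⁻ s in Ioc 0 t, ‖φ' s‖ₑ := by
  rcases eq_or_ne (∫⁻ s in Ioc 0 t, ‖φ' s‖ₑ) ∞ with htop | htop
  · rw [htop]; exact le_top
  have hinteg : IntervalIntegrable φ' volume 0 t := by
    rw [intervalIntegrable_iff_integrableOn_Ioc_of_le ht]
    exact ⟨hm, lt_top_iff_ne_top.2 htop⟩
  have hmaps : MapsTo (fun r => t - r) (Icc 0 t) (Icc 0 t) :=
    fun r hr => ⟨by linarith [hr.2], by linarith [hr.1]⟩
  have h := intervalIntegral.integral_eq_sub_of_hasDeriv_right_of_le (a := 0) (b := t)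
    (f := fun r => φ (t - r)) (f' := fun r => -φ' (t - r)) ht
    (hc.comp (by fun_prop) hmaps) (fun r hr => ?_) ?_
  · simp only [sub_self, sub_zero] at h
    rw [intervalIntegral.integral_neg,
      intervalIntegral.integral_comp_sub_left (fun s => φ' s) t, sub_self, sub_zero] at h
    have h' : φ t - φ 0 = ∫ s in (0 : ℝ)..t, φ' s := by
      rw [← neg_sub, ← h, neg_neg]
    rw [h', intervalIntegral.integral_of_le ht]
    exact enorm_integral_le_lintegral_enorm _
  · have h1 := hd (t - r) ⟨by linarith [hr.2], by linarith [hr.1]⟩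
    have h2 : HasDerivWithinAt (fun r => t - r) (-1) (Ioi r) r :=
      (hasDerivWithinAt_id r _).const_sub t
    have hmaps' : MapsTo (fun u => t - u) (Ioi r) (Iic (t - r)) := fun u hu => by
      rw [mem_Iic]
      linarith [mem_Ioi.1 hu]
    have := h1.scomp r h2 hmaps'
    simpa using! this
  · have := (hinteg.comp_sub_left t).symm.neg
    rwa [sub_self, sub_zero] at this

variable [MeasurableSpace V] [BorelSpace V] [SecondCountableTopology V]
  {Ω : Type*} [MeasurableSpace Ω]

/-- The left derivative of a continuous stochastic process is jointly measurable. -/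
lemma measurable_indicator_of_hasDerivWithinAt_Iic {φ φ' : ℝ → Ω → V} {t : ℝ} (ht : 0 ≤ t)
    (hm : ∀ s ∈ Icc 0 t, Measurable (φ s)) (hc : ∀ ω, ContinuousOn (fun s => φ s ω) (Icc 0 t))
    (hd : ∀ ω, ∀ s ∈ Ioc 0 t, HasDerivWithinAt (fun s => φ s ω) (φ' s ω) (Iic s) s) :
    Measurable fun q : ℝ × Ω => (Ioc 0 t).indicator (fun s => φ' s q.2) q.1 := by
  set ψ : ℝ → Ω → V := fun s ω => φ (projIcc 0 t ht s) ω with hψ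
  have hψm : Measurable (Function.uncurry ψ) := by
    refine measurable_uncurry_of_continuous_of_measurable (fun ω => ?_)
      (fun s => hm _ (projIcc 0 t ht s).2)
    exact (continuousOn_iff_continuous_domRestrict.1 (hc ω)).comp continuous_projIcc
  have hε : Tendsto (fun n : ℕ => 1 / ((n : ℝ) + 1)) atTop (𝓝 0) :=
    tendsto_one_div_add_atTop_nhds_zero_nat
  refine measurable_of_tendsto_metrizable (f := fun (n : ℕ) (q : ℝ × Ω) =>
    (Ioc 0 t ×ˢ (univ : Set Ω)).indicator (fun q : ℝ × Ω =>
      ((n : ℝ) + 1) • (ψ q.1 q.2 - ψ (q.1 - 1 / ((n : ℝ) + 1)) q.2)) q) (fun n => ?_) ?_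
  · refine Measurable.indicator ?_ (measurableSet_Ioc.prod MeasurableSet.univ)
    refine Measurable.const_smul (Measurable.sub hψm ?_) _
    exact hψm.comp ((measurable_fst.sub_const _).prodMk measurable_snd)
  · rw [tendsto_pi_nhds]
    rintro ⟨s, ω⟩
    by_cases hs : s ∈ Ioc 0 t
    · simp only [mem_prod, hs, mem_univ, and_self, indicator_of_mem]
      have h1 := (hasDerivWithinAt_iff_tendsto_slope.1 (hd ω s hs))
      have h2 : Tendsto (fun n : ℕ => s - 1 / ((n : ℝ) + 1)) atTop (𝓝[Iic s \ {s}] s) := by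
        refine tendsto_nhdsWithin_iff.2 ⟨by simpa using hε.const_sub s, Eventually.of_forall ?_⟩
        intro n
        have : 0 < 1 / ((n : ℝ) + 1) := by positivity
        refine ⟨by simp only [mem_Iic]; linarith, ?_⟩
        simp only [mem_singleton_iff]
        linarith
      refine (h1.comp h2).congr' ?_
      filter_upwards [hε.eventually (gt_mem_nhds hs.1)] with n hn
      have h0 : 0 < 1 / ((n : ℝ) + 1) := by positivity
      have hmem : s - 1 / ((n : ℝ) + 1) ∈ Icc 0 t := ⟨by linarith, by linarith [hs.2]⟩
      simp only [hψ, projIcc_of_mem ht (Ioc_subset_Icc_self hs), projIcc_of_mem ht hmem,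
        Function.comp_apply, slope_def_module]
      rw [sub_sub_cancel_left, inv_neg, one_div, inv_inv, neg_smul, ← smul_neg, neg_sub]
    · simp [hs]

/-- `L^p` bound for the increment of a stochastic process in terms of its left derivative. -/
lemma eLpNorm_sub_le_lintegral_of_hasDerivWithinAt_Iic [CompleteSpace V] {μ : Measure Ω}
    [IsFiniteMeasure μ] {φ φ' : ℝ → Ω → V} {t p : ℝ} (ht : 0 ≤ t) (hp : 1 ≤ p)
    (hm : ∀ s ∈ Icc 0 t, Measurable (φ s)) (hc : ∀ ω, ContinuousOn (fun s => φ s ω) (Icc 0 t))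
    (hd : ∀ ω, ∀ s ∈ Ioc 0 t, HasDerivWithinAt (fun s => φ s ω) (φ' s ω) (Iic s) s) :
    eLpNorm (fun ω => φ t ω - φ 0 ω) (ENNReal.ofReal p) μ ≤
      ∫⁻ s in Ioc 0 t, eLpNorm (φ' s) (ENNReal.ofReal p) μ := by
  have hmeas := measurable_indicator_of_hasDerivWithinAt_Iic ht hm hc hd
  refine (eLpNorm_le_lintegral_eLpNorm (ν := volume.restrict (Ioc 0 t))
    (g := fun s ω => (Ioc 0 t).indicator (fun s => φ' s ω) s) hmeas.enorm (fun ω => ?_) hp).trans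
    (le_of_eq ?_)
  · have hmω : Measurable ((Ioc 0 t).indicator (fun s => φ' s ω)) :=
      hmeas.comp measurable_prodMk_right
    refine (enorm_sub_le_lintegral_of_hasDerivWithinAt_Iic ht (hc ω) (hd ω) ?_).trans
      (le_of_eq ?_)
    · exact (aestronglyMeasurable_indicator_iff measurableSet_Ioc).1 hmω.aestronglyMeasurable
    · refine setLIntegral_congr_fun measurableSet_Ioc fun s hs => ?_
      simp [hs]
  · refine setLIntegral_congr_fun measurableSet_Ioc fun s hs => ?_
    simp [hs]

end Lp

section MildFlow

open Filter Topology

variable {V : Type*} [NormedAddCommGroup V] [NormedSpace ℝ V]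

/-- `S` is a norm continuous one-parameter group, and `X s r x` is the value at time `r` of a
continuous mild solution on `[s, T]` of the equation with linear part `S`, nonlinearity `F`, and
additive noise path `O`, that starts at `x` at time `s`. -/
structure IsMildFlow (S : ℝ → V →L[ℝ] V) (F : V → V) (O : ℝ → V) (X : ℝ → ℝ → V → V) (T : ℝ) :
    Prop where
  continuous_group : Continuous S
  group_zero : ∀ v, S 0 v = v
  group_add : ∀ s t v, S (s + t) v = S s (S t v)
  contDiff : ContDiff ℝ 1 F
  continuousOn_noise : ContinuousOn O (Icc 0 T)
  continuousOn : ∀ s ∈ Icc 0 T, ∀ x, ContinuousOn (fun r => X s r x) (Icc s T)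
  eq_integral : ∀ s ∈ Icc 0 T, ∀ x, ∀ r ∈ Icc s T,
    X s r x = S (r - s) x + (∫ u in s..r, S (r - u) (F (X s u x))) + O r - S (r - s) (O s)

namespace IsMildFlow

variable {S : ℝ → V →L[ℝ] V} {F : V → V} {O : ℝ → V} {X : ℝ → ℝ → V → V} {T : ℝ}

lemma group_neg_apply (h : IsMildFlow S F O X T) (t : ℝ) (v : V) : S (-t) (S t v) = v := by
  rw [← h.group_add, neg_add_cancel, h.group_zero]

lemma group_apply_neg (h : IsMildFlow S F O X T) (t : ℝ) (v : V) : S t (S (-t) v) = v := by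
  rw [← h.group_add, add_neg_cancel, h.group_zero]

lemma apply_self (h : IsMildFlow S F O X T) {s : ℝ} (hs : s ∈ Icc 0 T) (x : V) : X s s x = x := by
  rw [h.eq_integral s hs x s ⟨le_rfl, hs.2⟩]
  simp [h.group_zero]

/-- The vector field of the equation in the variable `S (-t) (X s t x - O t)`. -/
def field (S : ℝ → V →L[ℝ] V) (F : V → V) (O : ℝ → V) (u : ℝ) (w : V) : V :=
  S (-u) (F (S u w + O u))

/-- The flow in the variable `S (-t) (X s t x - O t)`. -/
def conj (S : ℝ → V →L[ℝ] V) (O : ℝ → V) (X : ℝ → ℝ → V → V) (s r : ℝ) (w : V) : V :=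
  S (-r) (X s r (S s w + O s) - O r)

lemma continuous_field (h : IsMildFlow S F O X T) (hO : Continuous O) :
    Continuous fun q : ℝ × V => field S F O q.1 q.2 := by
  have hS := h.continuous_group
  have hF := h.contDiff.continuous
  have h1 : Continuous fun q : ℝ × V => S q.1 q.2 + O q.1 :=
    ((hS.comp continuous_fst).clm_apply continuous_snd).add (hO.comp continuous_fst)
  exact (hS.comp continuous_fst.neg).clm_apply (hF.comp h1)

lemma hasFDerivAt_field (h : IsMildFlow S F O X T) (u : ℝ) (w : V) :
    HasFDerivAt (field S F O u) ((S (-u)).comp ((fderiv ℝ F (S u w + O u)).comp (S u))) w := by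
  have hF : HasFDerivAt F (fderiv ℝ F (S u w + O u)) (S u w + O u) :=
    (h.contDiff.differentiable (by norm_num) _).hasFDerivAt
  exact (S (-u)).hasFDerivAt.comp w (hF.comp w ((S u).hasFDerivAt.add_const (O u)))

lemma continuous_fderiv_field (h : IsMildFlow S F O X T) (hO : Continuous O) :
    Continuous fun q : ℝ × V => fderiv ℝ (field S F O q.1) q.2 := by
  simp only [fun u w => (h.hasFDerivAt_field u w).fderiv]
  have hS := h.continuous_group
  have hF := h.contDiff.continuous_fderiv (by norm_num)
  have h1 : Continuous fun q : ℝ × V => S q.1 q.2 + O q.1 :=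
    ((hS.comp continuous_fst).clm_apply continuous_snd).add (hO.comp continuous_fst)
  exact (hS.comp continuous_fst.neg).clm_comp ((hF.comp h1).clm_comp (hS.comp continuous_fst))

lemma apply_eq (h : IsMildFlow S F O X T) (s r : ℝ) (x : V) :
    X s r x = S r (conj S O X s r (S (-s) (x - O s))) + O r := by
  simp [conj, h.group_apply_neg]

/-- The noise path outside `[0, T]` is irrelevant. -/
lemma exists_continuous (h : IsMildFlow S F O X T) (hT : 0 ≤ T) :
    ∃ O' : ℝ → V, Continuous O' ∧ EqOn O' O (Icc 0 T) ∧ IsMildFlow S F O' X T := by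
  have heq : EqOn (IccExtend hT ((Icc 0 T).domRestrict O)) O (Icc 0 T) :=
    fun s hs => by rw [IccExtend_of_mem hT _ hs]; rfl
  have hc : Continuous (IccExtend hT ((Icc 0 T).domRestrict O)) :=
    (continuousOn_iff_continuous_domRestrict.1 h.continuousOn_noise).Icc_extend'
  refine ⟨_, hc, heq, { h with
    continuousOn_noise := hc.continuousOn
    eq_integral := fun s hs x r hr => ?_ }⟩
  rw [heq hs, heq ⟨hs.1.trans hr.1, hr.2⟩, h.eq_integral s hs x r hr]

variable [CompleteSpace V]

lemma conj_eq (h : IsMildFlow S F O X T) {s r : ℝ} (hs : s ∈ Icc 0 T) (hr : r ∈ Icc s T) (w : V) :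
    conj S O X s r w = w + ∫ u in s..r, field S F O u (conj S O X s u w) := by
  have hinteg : ContinuousOn (fun u => S (r - u) (F (X s u (S s w + O s)))) (uIcc s r) := by
    rw [uIcc_of_le hr.1]
    exact (h.continuous_group.comp (by fun_prop)).continuousOn.clm_apply
      (h.contDiff.continuous.comp_continuousOn ((h.continuousOn s hs _).mono
        (Icc_subset_Icc_right hr.2)))
  rw [conj, h.eq_integral s hs _ r hr]
  have : S (r - s) (S s w + O s) + (∫ u in s..r, S (r - u) (F (X s u (S s w + O s)))) + O r -
      S (r - s) (O s) - O r = S r w + ∫ u in s..r, S (r - u) (F (X s u (S s w + O s))) := by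
    rw [map_add, ← h.group_add, sub_add_cancel]
    abel
  rw [this, map_add, h.group_neg_apply,
    ← (S (-r)).intervalIntegral_comp_comm hinteg.intervalIntegrable]
  congr 1
  refine intervalIntegral.integral_congr fun u _ => ?_
  simp only [field, conj, h.group_apply_neg, sub_add_cancel, ← h.group_add]
  congr 2
  ring

lemma isForwardFlow (h : IsMildFlow S F O X T) (hO : Continuous O) :
    IsForwardFlow (conj S O X) (field S F O) T where
  isIntegralCurveOn s hs w t ht := by
    have hc : ContinuousOn (fun r => conj S O X s r w) (Icc s T) :=
      (h.continuous_group.comp continuous_neg).continuousOn.clm_apply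
        ((h.continuousOn s hs _).sub hO.continuousOn)
    refine (ODE.hasDerivWithinAt_picard_Icc (u := univ) (left_mem_Icc.2 hs.2)
      (h.continuous_field hO).continuousOn hc (fun _ _ => mem_univ _) w ht).congr_of_mem
      (fun r hr => ?_) ht
    rw [ODE.picard_apply, h.conj_eq hs hr]
  apply_self s hs w := by
    simpa using h.conj_eq hs (left_mem_Icc.2 hs.2) w

variable [ProperSpace V]

lemma hasFDerivAt_of_continuous (h : IsMildFlow S F O X T) (hO : Continuous O) {s t : ℝ}
    (hs : 0 ≤ s) (hst : s ≤ t) (htT : t ≤ T) (x : V) :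
    HasFDerivAt (X s t) ((S t).comp
      ((fderiv ℝ (conj S O X s t) (S (-s) (x - O s))).comp (S (-s)))) x := by
  have hW := ((h.isForwardFlow hO).differentiableAt
    (fun u w => (h.hasFDerivAt_field u w).differentiableAt)
    (h.continuous_fderiv_field hO) hs hst htT (S (-s) (x - O s))).hasFDerivAt
  have heq : X s t = fun x => S t (conj S O X s t (S (-s) (x - O s))) + O t :=
    funext fun x => h.apply_eq s t x
  rw [heq]
  exact ((S t).hasFDerivAt.comp x (hW.comp x
    ((S (-s)).hasFDerivAt.comp x ((hasFDerivAt_id x).sub_const (O s))))).add_const (O t)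

/-- A mild flow is differentiable with respect to the initial value. -/
lemma differentiableAt (h : IsMildFlow S F O X T) {s t : ℝ}
    (hs : 0 ≤ s) (hst : s ≤ t) (htT : t ≤ T) (x : V) : DifferentiableAt ℝ (X s t) x := by
  obtain ⟨O', hO', -, h'⟩ := h.exists_continuous (hs.trans (hst.trans htT))
  exact (h'.hasFDerivAt_of_continuous hO' hs hst htT x).differentiableAt

/-- Left derivative of a mild flow that is evaluated along a perturbed mild solution. -/
lemma hasDerivWithinAt_comp (h : IsMildFlow S F O X T) {P : ℝ → V} {p : V} {s t : ℝ}
    (hs : 0 < s) (hst : s ≤ t) (htT : t ≤ T) (hP : HasDerivWithinAt P p (Iic s) s) :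
    HasDerivWithinAt (fun r => X r t (S r (P r) + O r))
      (fderiv ℝ (X s t) (S s (P s) + O s) (S s p - F (S s (P s) + O s))) (Iic s) s := by
  obtain ⟨O', hO', heq, h'⟩ := h.exists_continuous (hs.le.trans (hst.trans htT))
  have hfd := (h'.hasFDerivAt_of_continuous hO' hs.le hst htT (S s (P s) + O' s)).fderiv
  rw [add_sub_cancel_right, h.group_neg_apply] at hfd
  have hW := (h'.isForwardFlow hO').hasDerivWithinAt_comp (h'.continuous_field hO')
    (fun u w => (h'.hasFDerivAt_field u w).differentiableAt)
    (h'.continuous_fderiv_field hO') hs hst htT hP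
  have hX := ((S t).hasFDerivAt.comp_hasDerivWithinAt s hW).add_const (O' t)
  rw [← heq ⟨hs.le, hst.trans htT⟩, hfd]
  simp only [ContinuousLinearMap.comp_apply, map_sub, h.group_neg_apply]
  simp only [map_sub, field] at hX
  have hev : ∀ r, 0 < r → r ≤ s → X r t (S r (P r) + O r) =
      S t (conj S O' X r t (P r)) + O' t := by
    intro r hr0 hr
    rw [← heq ⟨hr0.le, hr.trans (hst.trans htT)⟩, h'.apply_eq r t, add_sub_cancel_right,
      h.group_neg_apply]
  refine hX.congr_of_eventuallyEq ?_ (hev s hs le_rfl)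
  filter_upwards [self_mem_nhdsWithin, nhdsWithin_le_nhds (lt_mem_nhds hs)] with r hr hr0
  exact hev r hr0 hr

lemma continuousOn_comp (h : IsMildFlow S F O X T) {P P' : ℝ → V} {t : ℝ} (ht : 0 ≤ t)
    (htT : t ≤ T) (hPc : ContinuousOn P (Icc 0 t))
    (hP : ∀ s ∈ Ioc 0 t, HasDerivWithinAt P (P' s) (Iic s) s) :
    ContinuousOn (fun r => X r t (S r (P r) + O r)) (Icc 0 t) := by
  obtain ⟨O', hO', heq, h'⟩ := h.exists_continuous (ht.trans htT)
  have hW := (h'.isForwardFlow hO').continuousOn_comp (h'.continuous_field hO')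
    (fun u w => (h'.hasFDerivAt_field u w).differentiableAt)
    (h'.continuous_fderiv_field hO') htT hPc hP
  refine ((S t).continuous.comp_continuousOn hW |>.add_const (O' t)).congr fun r hr => ?_
  rw [← heq ⟨hr.1, hr.2.trans htT⟩, h'.apply_eq r t, add_sub_cancel_right, h.group_neg_apply]
  rfl

end IsMildFlow

end MildFlow

section Diagonal

variable {H : Type*} [NormedAddCommGroup H] [InnerProductSpace ℝ H] {ι : Type*} [Fintype ι]

/-- The linear operator with eigenvalues `m` with respect to the orthonormal basis `b`. -/
noncomputable def diagonalCLM (b : OrthonormalBasis ι ℝ H) (m : ι → ℝ) : H →L[ℝ] H :=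
  ∑ i, m i • (innerSL ℝ (b i)).smulRight (b i)

variable (b : OrthonormalBasis ι ℝ H)

lemma diagonalCLM_apply (m : ι → ℝ) (v : H) :
    diagonalCLM b m v = ∑ i, (m i * ⟪b i, v⟫) • b i := by
  simp [diagonalCLM, smul_smul]

lemma inner_diagonalCLM (m : ι → ℝ) (v : H) (i : ι) :
    ⟪b i, diagonalCLM b m v⟫ = m i * ⟪b i, v⟫ := by
  rw [diagonalCLM_apply, b.orthonormal.inner_right_fintype]

lemma OrthonormalBasis.ext_inner {v w : H} (h : ∀ i, ⟪b i, v⟫ = ⟪b i, w⟫) : v = w := by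
  rw [← b.sum_repr' v, ← b.sum_repr' w]
  simp [h]

lemma diagonalCLM_one (v : H) : diagonalCLM b (fun _ => 1) v = v :=
  b.ext_inner fun i => by rw [inner_diagonalCLM, one_mul]

lemma diagonalCLM_mul_apply (m n : ι → ℝ) (v : H) :
    diagonalCLM b (fun i => m i * n i) v = diagonalCLM b m (diagonalCLM b n v) :=
  b.ext_inner fun i => by simp only [inner_diagonalCLM, mul_assoc]

lemma diagonalCLM_sub_apply (m n : ι → ℝ) (v : H) :
    diagonalCLM b (fun i => m i - n i) v = diagonalCLM b m v - diagonalCLM b n v :=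
  b.ext_inner fun i => by simp only [inner_diagonalCLM, inner_sub_right, sub_mul]

lemma norm_diagonalCLM_le {m n : ι → ℝ} {K : ℝ} (hK : 0 ≤ K) (h : ∀ i, |m i| ≤ K * |n i|) (v : H) :
    ‖diagonalCLM b m v‖ ≤ K * ‖diagonalCLM b n v‖ := by
  refine le_of_sq_le_sq ?_ (by positivity)
  rw [mul_pow, ← b.sum_sq_norm_inner_right, ← b.sum_sq_norm_inner_right, Finset.mul_sum]
  refine Finset.sum_le_sum fun i _ => ?_
  rw [inner_diagonalCLM, inner_diagonalCLM, ← mul_pow, norm_mul, norm_mul, ← mul_assoc]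
  gcongr
  exact h i

lemma norm_diagonalCLM_le_norm {m : ι → ℝ} {K : ℝ} (hK : 0 ≤ K) (h : ∀ i, |m i| ≤ K) (v : H) :
    ‖diagonalCLM b m v‖ ≤ K * ‖v‖ := by
  have := norm_diagonalCLM_le b (n := fun _ => 1) hK (by simpa using h) v
  rwa [diagonalCLM_one] at this

lemma continuous_diagonalCLM {Y : Type*} [TopologicalSpace Y] {m : Y → ι → ℝ}
    (h : ∀ i, Continuous fun t => m t i) : Continuous fun t => diagonalCLM b (m t) :=
  continuous_finsetSum _ fun i _ => (h i).smul continuous_const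

end Diagonal

section Scalar

lemma one_sub_exp_neg_le_rpow {x r : ℝ} (hx : 0 ≤ x) (hr : 0 ≤ r) (hr1 : r ≤ 1) :
    1 - Real.exp (-x) ≤ x ^ r := by
  rcases le_total x 1 with h | h
  · have h1 : x ^ (1 : ℝ) ≤ x ^ r := by
      rcases hx.eq_or_lt with rfl | hx0
      · rcases hr.eq_or_lt with rfl | hr0
        · simp
        · simp [hr0.ne']
      · exact Real.rpow_le_rpow_of_exponent_ge hx0 h hr1
    rw [Real.rpow_one] at h1
    linarith [Real.one_sub_le_exp_neg x]
  · linarith [Real.one_le_rpow h hr, Real.exp_pos (-x)]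

lemma rpow_mul_exp_neg_le_one {x r : ℝ} (hx : 0 ≤ x) (hr : 0 ≤ r) (hr1 : r ≤ 1) :
    x ^ r * Real.exp (-x) ≤ 1 := by
  have h1 : x ^ r ≤ Real.exp x := by
    rcases le_total x 1 with h | h
    · exact (Real.rpow_le_one hx h hr).trans (Real.one_le_exp hx)
    · calc x ^ r ≤ x ^ (1 : ℝ) := Real.rpow_le_rpow_of_exponent_le h hr1
        _ ≤ Real.exp x := by rw [Real.rpow_one]; linarith [Real.add_one_le_exp x]
  calc x ^ r * Real.exp (-x) ≤ Real.exp x * Real.exp (-x) := by gcongr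
    _ = 1 := by rw [← Real.exp_add]; simp

lemma abs_exp_sub_one_le {τ l r : ℝ} (hτ : 0 ≤ τ) (hl : l < 0) (hr : 0 ≤ r) (hr1 : r ≤ 1) :
    |Real.exp (τ * l) - 1| ≤ τ ^ r * (-l) ^ r := by
  have h1 : Real.exp (τ * l) ≤ 1 := Real.exp_le_one_iff.2 (by nlinarith)
  rw [abs_sub_comm, abs_of_nonneg (by linarith), ← Real.mul_rpow hτ (by linarith)]
  have := one_sub_exp_neg_le_rpow (x := τ * -l) (mul_nonneg hτ (by linarith)) hr hr1
  simpa using this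

lemma rpow_mul_exp_le {τ l r : ℝ} (hτ : 0 < τ) (hl : l < 0) (hr : 0 ≤ r) (hr1 : r ≤ 1) :
    (-l) ^ r * Real.exp (τ * l) ≤ τ ^ (-r) := by
  have h := rpow_mul_exp_neg_le_one (x := τ * -l) (mul_nonneg hτ.le (by linarith)) hr hr1
  rw [Real.mul_rpow hτ.le (by linarith)] at h
  have h2 : 0 < τ ^ r := Real.rpow_pos_of_pos hτ r
  rw [Real.rpow_neg hτ.le, ← one_div, le_div_iff₀ h2]
  simp only [mul_neg, neg_neg] at h
  linarith

lemma rpow_mul_abs_exp_sub_exp_le {τ σ l δ r : ℝ} (hτ : 0 ≤ τ) (hσ : 0 < σ) (hl : l < 0)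
    (hδ : 0 ≤ δ) (hr : 0 ≤ r) (hδr : δ + r ≤ 1) :
    (-l) ^ δ * |Real.exp ((τ + σ) * l) - Real.exp (σ * l)| ≤ τ ^ r * σ ^ (-(δ + r)) := by
  have hl' : 0 < -l := by linarith
  have h1 := abs_exp_sub_one_le hτ hl hr (by linarith)
  have h2 := rpow_mul_exp_le hσ hl (add_nonneg hδ hr) hδr
  have h3 : Real.exp ((τ + σ) * l) - Real.exp (σ * l)
      = (Real.exp (τ * l) - 1) * Real.exp (σ * l) := by
    rw [add_mul, Real.exp_add]; ring
  rw [h3, abs_mul, abs_of_pos (Real.exp_pos _)]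
  calc _ ≤ (-l) ^ δ * (τ ^ r * (-l) ^ r * Real.exp (σ * l)) := by gcongr
    _ = τ ^ r * ((-l) ^ (δ + r) * Real.exp (σ * l)) := by rw [Real.rpow_add hl']; ring
    _ ≤ _ := by gcongr

end Scalar

section Semigroup

variable {H : Type*} [NormedAddCommGroup H] [InnerProductSpace ℝ H] {ι : Type*} [Fintype ι]
  (b : OrthonormalBasis ι ℝ H) (lam : ι → ℝ)

/-- The semigroup generated by the diagonal operator with eigenvalues `lam`. -/
noncomputable def diagonalExp (t : ℝ) : H →L[ℝ] H :=
  diagonalCLM b fun i => Real.exp (t * lam i)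

/-- The fractional powers of the diagonal operator with eigenvalues `-lam`. -/
noncomputable def diagonalRpow (r : ℝ) : H →L[ℝ] H :=
  diagonalCLM b fun i => (-lam i) ^ r

lemma continuous_diagonalExp : Continuous (diagonalExp b lam) :=
  continuous_diagonalCLM b fun i => by fun_prop

lemma diagonalExp_zero (v : H) : diagonalExp b lam 0 v = v := by
  simp [diagonalExp, diagonalCLM_one]

lemma diagonalExp_add (s t : ℝ) (v : H) :
    diagonalExp b lam (s + t) v = diagonalExp b lam s (diagonalExp b lam t v) := by
  simp only [diagonalExp, add_mul, Real.exp_add, diagonalCLM_mul_apply]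

variable {b lam} (hlam : ∀ i, lam i < 0)
include hlam

lemma norm_diagonalExp_le {t : ℝ} (ht : 0 ≤ t) (v : H) : ‖diagonalExp b lam t v‖ ≤ ‖v‖ := by
  have := norm_diagonalCLM_le_norm b (m := fun i => Real.exp (t * lam i)) zero_le_one
    (fun i => by
      rw [abs_of_pos (Real.exp_pos _)]
      exact Real.exp_le_one_iff.2 (by nlinarith [hlam i])) v
  rwa [one_mul] at this

lemma norm_diagonalRpow_diagonalExp_le {t : ℝ} (ht : 0 ≤ t) (r : ℝ) (v : H) :
    ‖diagonalRpow b lam r (diagonalExp b lam t v)‖ ≤ ‖diagonalRpow b lam r v‖ := by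
  have : diagonalRpow b lam r (diagonalExp b lam t v)
      = diagonalExp b lam t (diagonalRpow b lam r v) := by
    simp only [diagonalExp, diagonalRpow, ← diagonalCLM_mul_apply, mul_comm]
  rw [this]
  exact norm_diagonalExp_le hlam ht _

lemma norm_diagonalExp_sub_le {t r : ℝ} (ht : 0 ≤ t) (hr : 0 ≤ r) (hr1 : r ≤ 1) (v : H) :
    ‖diagonalExp b lam t v - v‖ ≤ t ^ r * ‖diagonalRpow b lam r v‖ := by
  have h : diagonalExp b lam t v - v = diagonalCLM b (fun i => Real.exp (t * lam i) - 1) v := by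
    rw [diagonalCLM_sub_apply, diagonalCLM_one, diagonalExp]
  rw [h]
  refine norm_diagonalCLM_le b (by positivity) (fun i => ?_) v
  have hl : 0 < -lam i := by linarith [hlam i]
  rw [abs_of_pos (Real.rpow_pos_of_pos hl r)]
  exact abs_exp_sub_one_le ht (hlam i) hr hr1

lemma norm_diagonalRpow_diagonalExp_sub_le {s t γ δ : ℝ} (hs : 0 ≤ s) (hst : s ≤ t)
    (hδγ : δ ≤ γ) (hγ : γ ≤ δ + 1) (v : H) :
    ‖diagonalRpow b lam δ (diagonalExp b lam t v - diagonalExp b lam s v)‖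
      ≤ (t - s) ^ (γ - δ) * ‖diagonalRpow b lam γ v‖ := by
  have h1 : diagonalExp b lam t v - diagonalExp b lam s v
      = diagonalExp b lam s (diagonalExp b lam (t - s) v - v) := by
    rw [map_sub, ← diagonalExp_add, add_sub_cancel]
  have h2 : diagonalRpow b lam δ (diagonalExp b lam (t - s) v - v)
      = diagonalExp b lam (t - s) (diagonalRpow b lam δ v) - diagonalRpow b lam δ v := by
    rw [map_sub]
    simp only [diagonalExp, diagonalRpow, ← diagonalCLM_mul_apply, mul_comm]
  have h3 : diagonalRpow b lam (γ - δ) (diagonalRpow b lam δ v) = diagonalRpow b lam γ v := by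
    simp only [diagonalRpow, ← diagonalCLM_mul_apply]
    congr 2 with i
    rw [← Real.rpow_add (by linarith [hlam i]), sub_add_cancel]
  rw [h1]
  refine (norm_diagonalRpow_diagonalExp_le hlam hs δ _).trans ?_
  rw [h2, ← h3]
  exact norm_diagonalExp_sub_le hlam (by linarith) (by linarith) (by linarith) _

lemma norm_diagonalRpow_diagonalExp_le_rpow {t δ : ℝ} (ht : 0 < t) (hδ : 0 ≤ δ) (hδ1 : δ ≤ 1)
    (v : H) : ‖diagonalRpow b lam δ (diagonalExp b lam t v)‖ ≤ t ^ (-δ) * ‖v‖ := by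
  simp only [diagonalExp, diagonalRpow, ← diagonalCLM_mul_apply]
  refine norm_diagonalCLM_le_norm b (by positivity) (fun i => ?_) v
  have hl : 0 < -lam i := by linarith [hlam i]
  rw [abs_of_pos (by positivity)]
  exact rpow_mul_exp_le ht (hlam i) hδ hδ1

lemma norm_diagonalRpow_diagonalExp_sub_le_rpow {s t δ r : ℝ} (hs : 0 < s) (hst : s ≤ t)
    (hδ : 0 ≤ δ) (hr : 0 ≤ r) (hδr : δ + r ≤ 1) (v : H) :
    ‖diagonalRpow b lam δ (diagonalExp b lam t v - diagonalExp b lam s v)‖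
      ≤ (t - s) ^ r * s ^ (-(δ + r)) * ‖v‖ := by
  have h1 : diagonalRpow b lam δ (diagonalExp b lam t v - diagonalExp b lam s v)
      = diagonalCLM b (fun i => (-lam i) ^ δ * (Real.exp (t * lam i) - Real.exp (s * lam i))) v := by
    rw [diagonalCLM_mul_apply, diagonalCLM_sub_apply]
    rfl
  have hts : 0 ≤ t - s := by linarith
  rw [h1]
  refine norm_diagonalCLM_le_norm b (by positivity) (fun i => ?_) v
  have hl : 0 < -lam i := by linarith [hlam i]
  rw [abs_mul, abs_of_pos (Real.rpow_pos_of_pos hl δ)]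
  have := rpow_mul_abs_exp_sub_exp_le hts hs (hlam i) hδ hr hδr
  rwa [sub_add_cancel] at this

end Semigroup

section Grid

open Filter Topology

/-- `θ` is a finite grid of `[0, T]` with mesh `mesh`, and `lfl t` is the largest grid point
strictly before `t`. -/
structure IsGridFloor (θ : Finset ℝ) (T mesh : ℝ) (lfl : ℝ → ℝ) : Prop where
  zero_mem : (0 : ℝ) ∈ θ
  last_mem : T ∈ θ
  subset : ∀ x ∈ θ, x ∈ Icc (0 : ℝ) T
  isGreatest_mesh : IsGreatest
    {x : ℝ | 0 < x ∧ ∃ a ∈ θ, ∃ e ∈ θ, x = e - a ∧ ∀ z ∈ θ, ¬(a < z ∧ z < e)} mesh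
  isGreatest_floor : ∀ t : ℝ, 0 < t → IsGreatest {x : ℝ | x ∈ θ ∧ x < t} (lfl t)

namespace IsGridFloor

variable {θ : Finset ℝ} {T mesh : ℝ} {lfl : ℝ → ℝ} {s t u : ℝ}

lemma floor_mem (h : IsGridFloor θ T mesh lfl) (ht : 0 < t) : lfl t ∈ θ :=
  (h.isGreatest_floor t ht).1.1

lemma floor_lt (h : IsGridFloor θ T mesh lfl) (ht : 0 < t) : lfl t < t :=
  (h.isGreatest_floor t ht).1.2

lemma le_floor (h : IsGridFloor θ T mesh lfl) (ht : 0 < t) (hs : s ∈ θ) (hst : s < t) :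
    s ≤ lfl t :=
  (h.isGreatest_floor t ht).2 ⟨hs, hst⟩

lemma floor_mem_Icc (h : IsGridFloor θ T mesh lfl) (ht : 0 < t) : lfl t ∈ Icc 0 T :=
  h.subset _ (h.floor_mem ht)

lemma mesh_pos (h : IsGridFloor θ T mesh lfl) : 0 < mesh := h.isGreatest_mesh.1.1

lemma floor_eq (h : IsGridFloor θ T mesh lfl) (hs : 0 < s) (hu : u ∈ Ioc (lfl s) s) :
    lfl u = lfl s := by
  have hu0 : 0 < u := (h.floor_mem_Icc hs).1.trans_lt hu.1
  exact le_antisymm (h.le_floor hs (h.floor_mem hu0) ((h.floor_lt hu0).trans_le hu.2))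
    (h.le_floor hu0 (h.floor_mem hs) hu.1)

lemma floor_mono (h : IsGridFloor θ T mesh lfl) (hs : 0 < s) (hst : s ≤ t) : lfl s ≤ lfl t :=
  h.le_floor (hs.trans_le hst) (h.floor_mem hs) ((h.floor_lt hs).trans_le hst)

lemma sub_floor_le (h : IsGridFloor θ T mesh lfl) (hs : s ∈ Ioc 0 T) : s - lfl s ≤ mesh := by
  have hne : (θ.filter fun z => s ≤ z).Nonempty := ⟨T, by simp [h.last_mem, hs.2]⟩
  set e := (θ.filter fun z => s ≤ z).min' hne
  have he := Finset.mem_filter.1 (Finset.min'_mem _ hne)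
  have hse : s ≤ e := he.2
  have hle : e - lfl s ≤ mesh := by
    refine h.isGreatest_mesh.2 ⟨by linarith [h.floor_lt hs.1], lfl s, h.floor_mem hs.1, e, he.1,
      rfl, fun z hz hlt => ?_⟩
    rcases lt_or_ge z s with hzs | hzs
    · exact hlt.1.not_ge (h.le_floor hs.1 hz hzs)
    · exact hlt.2.not_ge (Finset.min'_le _ _ (Finset.mem_filter.2 ⟨hz, hzs⟩))
  linarith

lemma measurableSet_fiber (h : IsGridFloor θ T mesh lfl) (a : ℝ) :
    MeasurableSet {u | 0 < u ∧ lfl u = a} := by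
  refine OrdConnected.measurableSet ⟨fun x hx y hy z hz => ?_⟩
  have hz0 : 0 < z := hx.1.trans_le hz.1
  exact ⟨hz0, le_antisymm ((h.floor_mono hz0 hz.2).trans_eq hy.2)
    (hx.2.symm.trans_le (h.floor_mono hx.1 hz.1))⟩

lemma sum_indicator_fiber {V : Type*} [AddCommMonoid V] (h : IsGridFloor θ T mesh lfl) (g : ℝ → V)
    (hu : 0 < u) : ∑ a ∈ θ, {u | 0 < u ∧ lfl u = a}.indicator (fun _ => g a) u = g (lfl u) := by
  rw [Finset.sum_eq_single (lfl u)]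
  · simp [hu]
  · intro a _ ha
    simp [ha.symm]
  · exact fun hn => absurd (h.floor_mem hu) hn

variable {V : Type*} [NormedAddCommGroup V]

lemma integrableOn_indicator_fiber (h : IsGridFloor θ T mesh lfl) (t a : ℝ) (v : V) :
    IntegrableOn ({u | 0 < u ∧ lfl u = a}.indicator fun _ => v) (Ioc 0 t) := by
  refine Integrable.indicator ?_ (h.measurableSet_fiber a)
  exact integrable_const v

lemma intervalIntegrable (h : IsGridFloor θ T mesh lfl) (g : ℝ → V) (ht : 0 ≤ t) :
    IntervalIntegrable (fun u => g (lfl u)) volume 0 t := by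
  rw [intervalIntegrable_iff_integrableOn_Ioc_of_le ht]
  have h1 : IntegrableOn
      (fun u => ∑ a ∈ θ, {u | 0 < u ∧ lfl u = a}.indicator (fun _ => g a) u) (Ioc 0 t) :=
    integrable_finsetSum _ fun a _ => h.integrableOn_indicator_fiber t a (g a)
  exact h1.congr_fun (fun u hu => h.sum_indicator_fiber g hu.1) measurableSet_Ioc

variable [NormedSpace ℝ V]

lemma integral_eq_sum [CompleteSpace V] (h : IsGridFloor θ T mesh lfl) (g : ℝ → V) (ht : 0 ≤ t) :
    ∫ u in (0 : ℝ)..t, g (lfl u)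
      = ∑ a ∈ θ with a < t, volume.real ({u | 0 < u ∧ lfl u = a} ∩ Ioc 0 t) • g a := by
  rw [intervalIntegral.integral_of_le ht,
    ← setIntegral_congr_fun measurableSet_Ioc (fun u hu => h.sum_indicator_fiber g hu.1),
    integral_finsetSum _ fun a _ => h.integrableOn_indicator_fiber t a (g a), Finset.sum_filter]
  refine Finset.sum_congr rfl fun a _ => ?_
  rw [integral_indicator (h.measurableSet_fiber a), Measure.restrict_restrict
    (h.measurableSet_fiber a), setIntegral_const]
  split_ifs with hat
  · rfl
  · have : {u | 0 < u ∧ lfl u = a} ∩ Ioc 0 t = ∅ := by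
      refine eq_empty_of_forall_notMem fun u hu => hat ?_
      rw [← hu.1.2]
      exact (h.floor_lt hu.1.1).trans_le hu.2.2
    simp [this]

lemma continuousOn_integral (h : IsGridFloor θ T mesh lfl) (g : ℝ → V) (ht : 0 ≤ t) :
    ContinuousOn (fun s => ∫ u in (0 : ℝ)..s, g (lfl u)) (Icc 0 t) := by
  have := intervalIntegral.continuousOn_primitive_interval (a := 0) (b := t)
    (f := fun u => g (lfl u)) (μ := volume) ?_
  · rwa [uIcc_of_le ht] at this
  · rw [uIcc_of_le ht, integrableOn_Icc_iff_integrableOn_Ioc,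
      ← intervalIntegrable_iff_integrableOn_Ioc_of_le ht]
    exact h.intervalIntegrable g ht

lemma integral_eq_add [CompleteSpace V] (h : IsGridFloor θ T mesh lfl) (g : ℝ → V) (hs : 0 < s)
    (hu : u ∈ Icc (lfl s) s) :
    ∫ r in (0 : ℝ)..u, g (lfl r)
      = (∫ r in (0 : ℝ)..lfl s, g (lfl r)) + (u - lfl s) • g (lfl s) := by
  have hl := (h.floor_mem_Icc hs).1
  rw [← intervalIntegral.integral_add_adjacent_intervals (h.intervalIntegrable g hl)
    ((h.intervalIntegrable g hl).symm.trans (h.intervalIntegrable g (hl.trans hu.1))),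
    intervalIntegral.integral_of_le hu.1,
    setIntegral_congr_fun measurableSet_Ioc
      (g := fun _ => g (lfl s)) (fun r hr => by simp only [h.floor_eq hs ⟨hr.1, hr.2.trans hu.2⟩]),
    setIntegral_const]
  simp [hu.1]

lemma hasDerivWithinAt_integral [CompleteSpace V] (h : IsGridFloor θ T mesh lfl) (g : ℝ → V)
    (hs : 0 < s) :
    HasDerivWithinAt (fun s => ∫ u in (0 : ℝ)..s, g (lfl u)) (g (lfl s)) (Iic s) s := by
  have h1 : HasDerivWithinAt
      (fun u => (∫ r in (0 : ℝ)..lfl s, g (lfl r)) + (u - lfl s) • g (lfl s)) (g (lfl s))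
      (Iic s) s := by
    simpa using ((((hasDerivAt_id s).sub_const (lfl s)).smul_const (g (lfl s))).const_add
      (∫ r in (0 : ℝ)..lfl s, g (lfl r))).hasDerivWithinAt
  refine h1.congr_of_eventuallyEq ?_ (h.integral_eq_add g hs ⟨(h.floor_lt hs).le, le_rfl⟩)
  filter_upwards [Ioc_mem_nhdsLE (h.floor_lt hs)] with u hu
  exact h.integral_eq_add g hs ⟨hu.1.le, hu.2⟩

end IsGridFloor

end Grid

section Measurability

open Filter Topology

variable {Ω V : Type*} [MeasurableSpace Ω] [NormedAddCommGroup V]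

lemma Measurable.apply_of_continuous [SecondCountableTopology V] [MeasurableSpace V] [BorelSpace V]
    {Z : V → Ω → V} {η : Ω → V} (hη : Measurable η)
    (hZ : ∀ x, Measurable (Z x)) (hc : ∀ ω, Continuous fun x => Z x ω) :
    Measurable fun ω => Z (η ω) ω :=
  (measurable_uncurry_of_continuous_of_measurable hc hZ).comp (hη.prodMk measurable_id)

lemma Measurable.fderiv_apply_of_differentiable [SecondCountableTopology V] [MeasurableSpace V]
    [BorelSpace V] [NormedSpace ℝ V] {Z : V → Ω → V} {η : Ω → V} (hη : Measurable η)
    (hZ : ∀ x, Measurable (Z x)) (hd : ∀ ω, Differentiable ℝ fun x => Z x ω) (v : V) :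
    Measurable fun ω => fderiv ℝ (fun x => Z x ω) (η ω) v := by
  refine measurable_of_tendsto_metrizable
    (f := fun (n : ℕ) ω => (n : ℝ) • (Z (η ω + (n : ℝ)⁻¹ • v) ω - Z (η ω) ω)) (fun n => ?_) ?_
  · have hc : ∀ ω, Continuous fun x => Z x ω := fun ω => (hd ω).continuous
    exact (((hη.add_const _).apply_of_continuous hZ hc).sub
      (hη.apply_of_continuous hZ hc)).const_smul (n : ℝ)
  · exact tendsto_pi_nhds.2 fun ω => (hd ω (η ω)).hasFDerivAt.lim v
      (tendsto_norm_atTop_atTop.comp tendsto_natCast_atTop_atTop)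

lemma StronglyMeasurable.clm_of_apply {H : Type*} [NormedAddCommGroup H] [InnerProductSpace ℝ H]
    [FiniteDimensional ℝ H] [NormedSpace ℝ V] {L : Ω → H →L[ℝ] V}
    (h : ∀ v, StronglyMeasurable fun ω => L ω v) : StronglyMeasurable L := by
  set b := stdOrthonormalBasis ℝ H
  have hL : L = fun ω => ∑ i, ContinuousLinearMap.smulRightL ℝ H V (innerSL ℝ (b i)) (L ω (b i)) := by
    ext ω v
    conv_lhs => rw [← b.sum_repr' v]
    simp
  rw [hL]
  exact Finset.stronglyMeasurable_fun_sum _ fun i _ =>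
    (ContinuousLinearMap.smulRightL ℝ H V (innerSL ℝ (b i))).continuous.comp_stronglyMeasurable
      (h (b i))

end Measurability

section Holder

variable {Ω V : Type*} [MeasurableSpace Ω] {μ : Measure Ω} [NormedAddCommGroup V]

lemma ENNReal.holderTriple_ofReal_two_mul (q : ℝ) :
    ENNReal.HolderTriple (.ofReal (2 * q)) (.ofReal (2 * q)) (.ofReal q) := by
  constructor
  rw [ENNReal.ofReal_mul zero_le_two, ENNReal.mul_inv (by simp) (by simp), ← add_mul]
  simp [ENNReal.inv_two_add_inv_two]

lemma eLpNorm_clm_apply_le [NormedSpace ℝ V] {L : Ω → V →L[ℝ] V} {R : Ω → V} (q : ℝ)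
    (hL : AEStronglyMeasurable L μ) (hR : AEStronglyMeasurable R μ) :
    eLpNorm (fun ω => L ω (R ω)) (.ofReal q) μ
      ≤ eLpNorm L (.ofReal (2 * q)) μ * eLpNorm R (.ofReal (2 * q)) μ := by
  have := ENNReal.holderTriple_ofReal_two_mul q
  refine (eLpNorm_le_eLpNorm_mul_eLpNorm_of_nnnorm (p := .ofReal (2 * q)) (q := .ofReal (2 * q))
    hL hR (fun L v => L v) 1 (.of_forall fun ω => ?_)).trans_eq (by rw [ENNReal.coe_one, one_mul])
  simpa using (L ω).le_opNNNorm (R ω)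

lemma eLpNorm_one_add_rpow_add_rpow_le [IsProbabilityMeasure μ] {a b : Ω → V}
    (ha : AEStronglyMeasurable a μ) (hb : AEStronglyMeasurable b μ) {q c : ℝ} (hq : 1 ≤ q)
    (hc : 1 ≤ c) :
    eLpNorm (fun ω => 1 + ‖a ω‖ ^ c + ‖b ω‖ ^ c) (.ofReal q) μ
      ≤ (1 + eLpNorm a (.ofReal (q * c)) μ + eLpNorm b (.ofReal (q * c)) μ) ^ c := by
  have hq0 : (0 : ℝ) ≤ q := by linarith
  have hq1 : 1 ≤ ENNReal.ofReal q := by simpa using hq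
  have hc0 : 0 < c := by linarith
  have ha' : AEStronglyMeasurable (fun ω => ‖a ω‖ ^ c) μ :=
    (ha.norm.aemeasurable.pow_const c).aestronglyMeasurable
  have hb' : AEStronglyMeasurable (fun ω => ‖b ω‖ ^ c) μ :=
    (hb.norm.aemeasurable.pow_const c).aestronglyMeasurable
  have h1 : eLpNorm (fun _ : Ω => (1 : ℝ)) (.ofReal q) μ ≤ 1 := by
    rw [eLpNorm_const _ (by simp; linarith) (NeZero.ne μ)]
    simp
  calc eLpNorm (fun ω => 1 + ‖a ω‖ ^ c + ‖b ω‖ ^ c) (.ofReal q) μ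
      ≤ eLpNorm (fun ω => 1 + ‖a ω‖ ^ c) (.ofReal q) μ
        + eLpNorm (fun ω => ‖b ω‖ ^ c) (.ofReal q) μ :=
        eLpNorm_add_le (aestronglyMeasurable_const.add ha') hb' hq1
    _ ≤ (eLpNorm (fun _ : Ω => (1 : ℝ)) (.ofReal q) μ + eLpNorm (fun ω => ‖a ω‖ ^ c) (.ofReal q) μ)
        + eLpNorm (fun ω => ‖b ω‖ ^ c) (.ofReal q) μ := by
        gcongr
        exact eLpNorm_add_le aestronglyMeasurable_const ha' hq1
    _ ≤ (1 ^ c + eLpNorm a (.ofReal (q * c)) μ ^ c) + eLpNorm b (.ofReal (q * c)) μ ^ c := by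
        rw [eLpNorm_norm_rpow _ hc0, eLpNorm_norm_rpow _ hc0, ← ENNReal.ofReal_mul hq0,
          ENNReal.one_rpow]
        gcongr
    _ ≤ (1 + eLpNorm a (.ofReal (q * c)) μ) ^ c + eLpNorm b (.ofReal (q * c)) μ ^ c := by
        gcongr
        exact ENNReal.add_rpow_le_rpow_add _ _ hc
    _ ≤ _ := ENNReal.add_rpow_le_rpow_add _ _ hc

lemma eLpNorm_le_of_lipschitz_growth [IsProbabilityMeasure μ] {W : Type*} [NormedAddCommGroup W]
    {g : Ω → W} {a₀ a b : Ω → V} {C c q : ℝ} (hC : 0 ≤ C) (hc : 1 ≤ c) (hq : 1 ≤ q)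
    (ha₀ : AEStronglyMeasurable a₀ μ) (ha : AEStronglyMeasurable a μ)
    (hb : AEStronglyMeasurable b μ)
    (hg : ∀ ω, ‖g ω‖ ≤ C * ‖a₀ ω‖ * (1 + ‖a ω‖ ^ c + ‖b ω‖ ^ c)) :
    eLpNorm g (.ofReal q) μ ≤ .ofReal C * (eLpNorm a₀ (.ofReal (2 * q)) μ *
      (1 + eLpNorm a (.ofReal (2 * q * c)) μ + eLpNorm b (.ofReal (2 * q * c)) μ) ^ c) := by
  have := ENNReal.holderTriple_ofReal_two_mul q
  set h : Ω → ℝ := fun ω => 1 + ‖a ω‖ ^ c + ‖b ω‖ ^ c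
  have hh : AEStronglyMeasurable h μ :=
    ((((ha.norm.aemeasurable.pow_const c).const_add 1).add
      (hb.norm.aemeasurable.pow_const c))).aestronglyMeasurable
  have hh0 : ∀ ω, 0 ≤ h ω := fun ω => by positivity
  have h1 : eLpNorm g (.ofReal q) μ ≤ eLpNorm (h • fun ω => C * ‖a₀ ω‖) (.ofReal q) μ := by
    refine eLpNorm_mono_real fun ω => (hg ω).trans (le_of_eq ?_)
    simp only [h, Pi.smul_apply', smul_eq_mul]; ring
  have h2 : eLpNorm (h • fun ω => C * ‖a₀ ω‖) (.ofReal q) μ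
      ≤ eLpNorm h (.ofReal (2 * q)) μ * eLpNorm (fun ω => C * ‖a₀ ω‖) (.ofReal (2 * q)) μ :=
    eLpNorm_smul_le_mul_eLpNorm (ha₀.norm.const_mul C) hh
  have h3 : eLpNorm (fun ω => C * ‖a₀ ω‖) (.ofReal (2 * q)) μ
      ≤ .ofReal C * eLpNorm a₀ (.ofReal (2 * q)) μ :=
    eLpNorm_le_mul_eLpNorm_of_ae_le_mul (.of_forall fun ω => by simp [abs_of_nonneg hC]) _
  have h4 := eLpNorm_one_add_rpow_add_rpow_le (q := 2 * q) ha hb (by linarith) hc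
  exact (h1.trans h2).trans ((mul_le_mul' h4 h3).trans_eq (by ring))

end Holder

section Scheme

variable {V : Type*} [NormedAddCommGroup V] [NormedSpace ℝ V]
  {S : ℝ → V →L[ℝ] V} {θ : Finset ℝ} {T mesh : ℝ} {lfl : ℝ → ℝ} {f : V → V}

lemma IsGridFloor.scheme_eq [CompleteSpace V] (h : IsGridFloor θ T mesh lfl)
    (hS : ∀ s t v, S (s + t) v = S s (S t v)) {x : V} {n y : ℝ → V}
    (hy : ∀ t ∈ Icc 0 T,
      y t = S t x + (∫ u in (0 : ℝ)..t, S (t - lfl u) (f (y (lfl u)))) + n t)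
    {t : ℝ} (ht : t ∈ Icc 0 T) :
    y t = S t (x + ∫ u in (0 : ℝ)..t, S (-lfl u) (f (y (lfl u)))) + n t := by
  rw [hy t ht, map_add, ← ContinuousLinearMap.intervalIntegral_comp_comm _
    (h.intervalIntegrable (fun a => S (-a) (f (y a))) ht.1)]
  simp only [← hS, sub_eq_add_neg]

lemma IsGridFloor.scheme_sub [CompleteSpace V] (h : IsGridFloor θ T mesh lfl) {x : V} {n y : ℝ → V}
    (hy : ∀ t ∈ Icc 0 T,
      y t = S t x + (∫ u in (0 : ℝ)..t, S (t - lfl u) (f (y (lfl u)))) + n t)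
    {s : ℝ} (hs : s ∈ Ioc 0 T) :
    y s - y (lfl s) = (S s x - S (lfl s) x)
      + (∫ u in (0 : ℝ)..lfl s,
          (S (s - lfl u) (f (y (lfl u))) - S (lfl s - lfl u) (f (y (lfl u)))))
      + (s - lfl s) • S (s - lfl s) (f (y (lfl s))) + (n s - n (lfl s)) := by
  have hl := h.floor_mem_Icc hs.1
  have hys := hy s ⟨hs.1.le, hs.2⟩
  rw [h.integral_eq_add (fun a => S (s - a) (f (y a))) hs.1 ⟨(h.floor_lt hs.1).le, le_rfl⟩] at hys
  rw [intervalIntegral.integral_sub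
    (h.intervalIntegrable (fun a => S (s - a) (f (y a))) hl.1)
    (h.intervalIntegrable (fun a => S (lfl s - a) (f (y a))) hl.1)]
  refine (congrArg₂ (· - ·) hys (hy (lfl s) hl)).trans ?_
  abel

variable {Ω : Type*} [MeasurableSpace Ω] [MeasurableSpace V] [BorelSpace V]
  [SecondCountableTopology V]

lemma IsGridFloor.measurable_scheme [CompleteSpace V] (h : IsGridFloor θ T mesh lfl) (hf : Measurable f)
    {ξ : Ω → V} (hξ : Measurable ξ) {n y : ℝ → Ω → V} (hn : ∀ t ∈ Icc 0 T, Measurable (n t))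
    (hy : ∀ t ∈ Icc 0 T, ∀ ω,
      y t ω = S t (ξ ω) + (∫ u in (0 : ℝ)..t, S (t - lfl u) (f (y (lfl u) ω))) + n t ω)
    {t : ℝ} (ht : t ∈ Icc 0 T) : Measurable (y t) := by
  have step : ∀ t ∈ Icc 0 T, (∀ a ∈ θ, a < t → Measurable (y a)) → Measurable (y t) := by
    intro t ht hlt
    have hyt : y t = fun ω => S t (ξ ω) + (∑ a ∈ θ with a < t,
        volume.real ({u | 0 < u ∧ lfl u = a} ∩ Ioc 0 t) • S (t - a) (f (y a ω))) + n t ω := by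
      ext1 ω
      rw [hy t ht ω, h.integral_eq_sum (fun a => S (t - a) (f (y a ω))) ht.1]
    rw [hyt]
    refine (((S t).measurable.comp hξ).add (Finset.measurable_fun_sum _ fun a ha => ?_)).add
      (hn t ht)
    obtain ⟨haθ, hat⟩ := Finset.mem_filter.1 ha
    exact ((S (t - a)).measurable.comp (hf.comp (hlt a haθ hat))).const_smul _
  refine step t ht fun a ha _ => ?_
  exact (θ.finite_toSet.wellFoundedOn (r := (· < ·))).induction (Finset.mem_coe.2 ha)
    fun a ha ih => step a (h.subset a ha) fun z hz hza => ih z hz hza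

lemma lintegral_Ioc_sub_rpow_neg_le {l T a : ℝ} (hl : l ∈ Icc 0 T) (ha : 0 ≤ a) (ha1 : a < 1) :
    ∫⁻ u in Ioc 0 l, ENNReal.ofReal ((l - u) ^ (-a)) ≤ ENNReal.ofReal (max T 1 / (1 - a)) := by
  have h1 : IntervalIntegrable (fun u : ℝ => (l - u) ^ (-a)) volume 0 l := by
    simpa using ((intervalIntegral.intervalIntegrable_rpow' (a := 0) (b := l) (r := -a)
      (by linarith)).comp_sub_left l).symm
  have h2 : ∫ u in (0 : ℝ)..l, (l - u) ^ (-a) = l ^ (1 - a) / (1 - a) := by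
    rw [intervalIntegral.integral_comp_sub_left fun u : ℝ => u ^ (-a)]
    rw [sub_self, sub_zero, integral_rpow (.inl (by linarith)), neg_add_eq_sub,
      Real.zero_rpow (by linarith), sub_zero]
  rw [← ofReal_integral_eq_lintegral_ofReal
    ((intervalIntegrable_iff_integrableOn_Ioc_of_le hl.1).1 h1),
    ← intervalIntegral.integral_of_le hl.1, h2]
  · have h3 : (0 : ℝ) < max T 1 := lt_max_of_lt_right one_pos
    have h4 : l ^ (1 - a) ≤ max T 1 :=
      calc l ^ (1 - a) ≤ max T 1 ^ (1 - a) :=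
            Real.rpow_le_rpow hl.1 (hl.2.trans (le_max_left _ _)) (by linarith)
        _ ≤ max T 1 ^ (1 : ℝ) :=
            Real.rpow_le_rpow_of_exponent_le (le_max_right _ _) (by linarith)
        _ = max T 1 := Real.rpow_one _
    exact ENNReal.ofReal_le_ofReal (div_le_div_of_nonneg_right h4 (by linarith))
  · filter_upwards [ae_restrict_mem measurableSet_Ioc] with u hu
    exact Real.rpow_nonneg (by linarith [hu.2]) _

lemma IsGridFloor.eLpNorm_le_of_kernel (h : IsGridFloor θ T mesh lfl) {μ : Measure Ω}
    [IsFiniteMeasure μ] {W : Type*} [NormedAddCommGroup W] {I : Ω → W} {z : ℝ → Ω → V} {l q : ℝ}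
    (hz : ∀ a ∈ θ, Measurable (z a)) {k : ℝ → ℝ} (hk : Measurable k) (hq : 1 ≤ q)
    (hI : ∀ ω, ‖I ω‖ₑ ≤ ∫⁻ u in Ioc 0 l, .ofReal (k u) * ‖z (lfl u) ω‖ₑ) :
    eLpNorm I (.ofReal q) μ ≤ (∫⁻ u in Ioc 0 l, .ofReal (k u)) *
      ⨆ u ∈ Icc 0 T, eLpNorm (z u) (.ofReal q) μ := by
  set Z : ℝ → Ω → V := fun u ω =>
    ∑ a ∈ θ, {u | 0 < u ∧ lfl u = a}.indicator (fun _ => z a ω) u with hZ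
  have hZeq : ∀ u, 0 < u → Z u = z (lfl u) := fun u hu => by
    ext1 ω
    exact h.sum_indicator_fiber (fun a => z a ω) hu
  have hZm : Measurable fun q : ℝ × Ω => Z q.1 q.2 := by
    refine Finset.measurable_fun_sum _ fun a ha => ?_
    have : (fun q : ℝ × Ω => {u | 0 < u ∧ lfl u = a}.indicator (fun _ => z a q.2) q.1)
        = (Prod.fst ⁻¹' {u | 0 < u ∧ lfl u = a}).indicator fun q : ℝ × Ω => z a q.2 := rfl
    rw [this]
    exact ((hz a ha).comp measurable_snd).indicator (measurable_fst (h.measurableSet_fiber a))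
  set g : ℝ → Ω → V := fun u => max (k u) 0 • Z u
  have hg : Measurable fun q : ℝ × Ω => ‖g q.1 q.2‖ₑ :=
    (((hk.comp measurable_fst).max measurable_const).smul hZm).enorm
  have hke : ∀ u, ‖max (k u) 0‖ₑ = ENNReal.ofReal (k u) := fun u => by
    rw [Real.enorm_eq_ofReal (le_max_right _ _), ENNReal.ofReal_max, ENNReal.ofReal_zero,
      max_eq_left zero_le]
  refine (eLpNorm_le_lintegral_eLpNorm (ν := volume.restrict (Ioc 0 l)) hg (fun ω => ?_) hq).trans ?_
  · refine (hI ω).trans_eq (setLIntegral_congr_fun measurableSet_Ioc fun u hu => ?_)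
    simp only [g, Pi.smul_apply, enorm_smul, hke, hZeq u hu.1]
  · rw [← lintegral_mul_const _ hk.ennreal_ofReal]
    refine setLIntegral_mono' measurableSet_Ioc fun u hu => ?_
    simp only [g]
    rw [eLpNorm_const_smul, hke, hZeq u hu.1]
    gcongr
    exact le_iSup₂ (f := fun u _ => eLpNorm (z u) (.ofReal q) μ) (lfl u) (h.floor_mem_Icc hu.1)

end Scheme

section SchemeMoments

variable {H : Type*} [NormedAddCommGroup H] [InnerProductSpace ℝ H] [FiniteDimensional ℝ H]
  [MeasurableSpace H] [BorelSpace H] {ι : Type*} [Fintype ι] {b : OrthonormalBasis ι ℝ H}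
  {lam : ι → ℝ} {Ω : Type*} [MeasurableSpace Ω] {μ : Measure Ω}
  {θ : Finset ℝ} {T mesh : ℝ} {lfl : ℝ → ℝ} {f : H → H} {ξ : Ω → H} {n y : ℝ → Ω → H}

lemma eLpNorm_mono_mul {V W : Type*} [NormedAddCommGroup V] [NormedAddCommGroup W] {g : Ω → V}
    {g' : Ω → W} {k K : ℝ} (hkK : k ≤ K) (h : ∀ ω, ‖g ω‖ ≤ k * ‖g' ω‖) (q : ℝ≥0∞) :
    eLpNorm g q μ ≤ .ofReal K * eLpNorm g' q μ :=
  eLpNorm_le_mul_eLpNorm_of_ae_le_mul (.of_forall fun ω => (h ω).trans (by gcongr)) q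

lemma IsGridFloor.eLpNorm_diagonalRpow_integral_le [IsFiniteMeasure μ] (h : IsGridFloor θ T mesh lfl)
    (hlam : ∀ i, lam i < 0) {z : ℝ → Ω → H} (hz : ∀ a ∈ θ, Measurable (z a)) {s δ r q : ℝ}
    (hs : s ∈ Ioc 0 T) (hδ : 0 ≤ δ) (hr : 0 ≤ r) (hδr : δ + r < 1) (hq : 1 ≤ q) :
    eLpNorm (fun ω => diagonalRpow b lam δ (∫ u in (0 : ℝ)..lfl s,
      (diagonalExp b lam (s - lfl u) (z (lfl u) ω)
        - diagonalExp b lam (lfl s - lfl u) (z (lfl u) ω)))) (.ofReal q) μ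
      ≤ .ofReal (max T 1 / (1 - (δ + r))) * (.ofReal (mesh ^ r) *
        ⨆ u ∈ Icc 0 T, eLpNorm (z u) (.ofReal q) μ) := by
  have hl := h.floor_mem_Icc hs.1
  have hls := (h.floor_lt hs.1).le
  have hsl : 0 ≤ s - lfl s := by linarith
  have hm := h.mesh_pos
  refine (h.eLpNorm_le_of_kernel (k := fun u => mesh ^ r * (lfl s - u) ^ (-(δ + r))) (l := lfl s)
    hz (by fun_prop) hq fun ω => ?_).trans ?_
  · rw [← ContinuousLinearMap.intervalIntegral_comp_comm _
      ((h.intervalIntegrable (fun a => diagonalExp b lam (s - a) (z a ω)) hl.1).sub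
        (h.intervalIntegrable (fun a => diagonalExp b lam (lfl s - a) (z a ω)) hl.1)),
      intervalIntegral.integral_of_le hl.1]
    refine (enorm_integral_le_lintegral_enorm _).trans (lintegral_mono_ae ?_)
    rw [← restrict_Ioo_eq_restrict_Ioc]
    filter_upwards [ae_restrict_mem measurableSet_Ioo] with u hu
    have hfu := h.floor_lt hu.1
    rw [← ofReal_norm, ← ofReal_norm, ← ENNReal.ofReal_mul (by
      have : 0 ≤ lfl s - u := by linarith [hu.2]
      positivity)]
    refine ENNReal.ofReal_le_ofReal ?_
    refine (norm_diagonalRpow_diagonalExp_sub_le_rpow hlam (by linarith [hu.2]) (by linarith)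
      hδ hr hδr.le _).trans ?_
    gcongr ?_ * _
    refine mul_le_mul ?_ ?_ ?_ (by positivity)
    · exact Real.rpow_le_rpow (by linarith) (by linarith [h.sub_floor_le hs]) hr
    · exact Real.rpow_le_rpow_of_nonpos (by linarith [hu.2]) (by linarith) (by linarith)
    · exact Real.rpow_nonneg (by linarith [hu.2]) _
  · rw [mul_left_comm, ← mul_assoc]
    gcongr
    simp only [ENNReal.ofReal_mul (Real.rpow_nonneg hm.le r)]
    rw [lintegral_const_mul' _ _ ENNReal.ofReal_ne_top]
    gcongr
    exact lintegral_Ioc_sub_rpow_neg_le hl (by linarith) hδr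

lemma IsGridFloor.eLpNorm_diagonalRpow_sub_le [IsFiniteMeasure μ] (h : IsGridFloor θ T mesh lfl)
    (hlam : ∀ i, lam i < 0) (hf : Measurable f) (hξ : Measurable ξ)
    (hn : ∀ t ∈ Icc 0 T, Measurable (n t))
    (hy : ∀ t ∈ Icc 0 T, ∀ ω, y t ω = diagonalExp b lam t (ξ ω)
      + (∫ u in (0 : ℝ)..t, diagonalExp b lam (t - lfl u) (f (y (lfl u) ω))) + n t ω)
    {o ζ : Ω → H} (ho : Measurable o) (hζ : Measurable ζ) {s γ δ r q : ℝ} (hs : s ∈ Ioc 0 T)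
    (hδ : 0 ≤ δ) (hδγ : δ ≤ γ) (hγ : γ < 1) (hr : 0 ≤ r) (hδr : δ + r < 1) (hq : 1 ≤ q) :
    eLpNorm (fun ω => diagonalRpow b lam δ
        (y (lfl s) ω - (y s ω - n s ω + o ω + diagonalExp b lam s (ζ ω - ξ ω)))) (.ofReal q) μ
      ≤ .ofReal (max T 1 / (1 - (δ + r))) *
        (.ofReal (mesh ^ (1 - δ)) * eLpNorm (fun ω => f (y (lfl s) ω)) (.ofReal q) μ +
          .ofReal (mesh ^ r) * (⨆ u ∈ Icc 0 T, eLpNorm (fun ω => f (y u ω)) (.ofReal q) μ) +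
          eLpNorm (fun ω => diagonalRpow b lam δ (n s ω - n (lfl s) ω)) (.ofReal q) μ +
          .ofReal (mesh ^ (γ - δ)) * eLpNorm (fun ω => diagonalRpow b lam γ (ξ ω)) (.ofReal q) μ +
          eLpNorm (fun ω => diagonalRpow b lam δ (n s ω - o ω)) (.ofReal q) μ +
          eLpNorm (fun ω => diagonalRpow b lam δ (ξ ω - ζ ω)) (.ofReal q) μ) := by
  have hl := h.floor_mem_Icc hs.1
  have hsT : s ∈ Icc 0 T := ⟨hs.1.le, hs.2⟩
  have hsl : 0 < s - lfl s := by linarith [h.floor_lt hs.1]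
  have hslm := h.sub_floor_le hs
  have hym : ∀ t ∈ Icc 0 T, Measurable (y t) := fun t ht => h.measurable_scheme hf hξ hn hy ht
  have hq1 : 1 ≤ ENNReal.ofReal q := by simpa using hq
  set A := diagonalRpow b lam
  set E := diagonalExp b lam
  set I : Ω → H := fun ω => ∫ u in (0 : ℝ)..lfl s,
    (E (s - lfl u) (f (y (lfl u) ω)) - E (lfl s - lfl u) (f (y (lfl u) ω)))
  set M := ENNReal.ofReal (max T 1 / (1 - (δ + r)))
  have hM : 1 ≤ M := by
    rw [ENNReal.one_le_ofReal, le_div_iff₀ (by linarith)]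
    linarith [le_max_right T 1]
  have hsub : ∀ ω, y s ω - y (lfl s) ω = (E s (ξ ω) - E (lfl s) (ξ ω)) + I ω
      + (s - lfl s) • E (s - lfl s) (f (y (lfl s) ω)) + (n s ω - n (lfl s) ω) := fun ω =>
    h.scheme_sub (fun t ht => hy t ht ω) hs
  have hfm : Measurable fun ω => f (y (lfl s) ω) := hf.comp (hym _ hl)
  have hEm : ∀ t, Measurable (E t) := fun t => (E t).continuous.measurable
  have hAm : ∀ t, Measurable (A t) := fun t => (A t).continuous.measurable
  have hg1 : Measurable fun ω => E s (ξ ω) - E (lfl s) (ξ ω) :=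
    ((hEm _).comp hξ).sub ((hEm _).comp hξ)
  have hg3 : Measurable fun ω => (s - lfl s) • E (s - lfl s) (f (y (lfl s) ω)) :=
    ((hEm _).comp hfm).const_smul (s - lfl s)
  have hg4 : Measurable fun ω => n s ω - n (lfl s) ω := (hn _ hsT).sub (hn _ hl)
  have hg5 : Measurable fun ω => n s ω - o ω := (hn _ hsT).sub ho
  have hg6 : Measurable fun ω => E s (ξ ω - ζ ω) := (hEm _).comp (hξ.sub hζ)
  have hg2 : Measurable I := by
    have : I = fun ω => y s ω - y (lfl s) ω - (E s (ξ ω) - E (lfl s) (ξ ω))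
      - (s - lfl s) • E (s - lfl s) (f (y (lfl s) ω)) - (n s ω - n (lfl s) ω) := by
      ext1 ω
      rw [hsub ω]; abel
    rw [this]
    exact ((((hym _ hsT).sub (hym _ hl)).sub hg1).sub hg3).sub hg4
  have b1 : eLpNorm (fun ω => A δ (E s (ξ ω) - E (lfl s) (ξ ω))) (.ofReal q) μ
      ≤ .ofReal (mesh ^ (γ - δ)) * eLpNorm (fun ω => A γ (ξ ω)) (.ofReal q) μ :=
    eLpNorm_mono_mul (Real.rpow_le_rpow hsl.le hslm (by linarith)) (fun ω =>
      norm_diagonalRpow_diagonalExp_sub_le hlam hl.1 (by linarith) hδγ (by linarith) _) _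
  have b2 : eLpNorm (fun ω => A δ (I ω)) (.ofReal q) μ
      ≤ M * (.ofReal (mesh ^ r) *
        ⨆ u ∈ Icc 0 T, eLpNorm (fun ω => f (y u ω)) (.ofReal q) μ) :=
    h.eLpNorm_diagonalRpow_integral_le hlam (z := fun u ω => f (y u ω))
      (fun a ha => hf.comp (hym a (h.subset a ha))) hs hδ hr hδr hq
  have b3 : eLpNorm (fun ω => A δ ((s - lfl s) • E (s - lfl s) (f (y (lfl s) ω)))) (.ofReal q) μ
      ≤ .ofReal (mesh ^ (1 - δ)) * eLpNorm (fun ω => f (y (lfl s) ω)) (.ofReal q) μ := by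
    refine eLpNorm_mono_mul (Real.rpow_le_rpow hsl.le hslm (by linarith)) (fun ω => ?_) _
    rw [map_smul, norm_smul, Real.norm_of_nonneg hsl.le, sub_eq_add_neg 1 δ,
      Real.rpow_add hsl, Real.rpow_one, mul_assoc]
    gcongr
    exact norm_diagonalRpow_diagonalExp_le_rpow hlam hsl hδ (by linarith) _
  have b6 : eLpNorm (fun ω => A δ (E s (ξ ω - ζ ω))) (.ofReal q) μ
      ≤ eLpNorm (fun ω => A δ (ξ ω - ζ ω)) (.ofReal q) μ :=
    eLpNorm_mono fun ω => norm_diagonalRpow_diagonalExp_le hlam hs.1.le δ _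
  have hadd : ∀ g g' : Ω → H, Measurable g → Measurable g' →
      eLpNorm (fun ω => A δ (g ω + g' ω)) (.ofReal q) μ
        ≤ eLpNorm (fun ω => A δ (g ω)) (.ofReal q) μ
          + eLpNorm (fun ω => A δ (g' ω)) (.ofReal q) μ := fun g g' hg hg' => by
    simp only [map_add]
    exact eLpNorm_add_le ((hAm δ).comp hg).aestronglyMeasurable
      ((hAm δ).comp hg').aestronglyMeasurable hq1
  have hneg : ∀ g : Ω → H, eLpNorm (fun ω => A δ (-g ω)) (.ofReal q) μ
      = eLpNorm (fun ω => A δ (g ω)) (.ofReal q) μ := fun g =>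
    eLpNorm_congr_norm_ae (.of_forall fun ω => by simp)
  have heq : ∀ ω, y (lfl s) ω - (y s ω - n s ω + o ω + E s (ζ ω - ξ ω))
      = -(((E s (ξ ω) - E (lfl s) (ξ ω)) + I ω
        + (s - lfl s) • E (s - lfl s) (f (y (lfl s) ω)) + (n s ω - n (lfl s) ω)))
        + (n s ω - o ω) + E s (ξ ω - ζ ω) := fun ω => by
    rw [← hsub ω, map_sub, map_sub]; abel
  simp only [heq]
  calc _ ≤ ((((eLpNorm (fun ω => A δ (E s (ξ ω) - E (lfl s) (ξ ω))) (.ofReal q) μ +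
        eLpNorm (fun ω => A δ (I ω)) (.ofReal q) μ) +
        eLpNorm (fun ω => A δ ((s - lfl s) • E (s - lfl s) (f (y (lfl s) ω)))) (.ofReal q) μ) +
        eLpNorm (fun ω => A δ (n s ω - n (lfl s) ω)) (.ofReal q) μ) +
        eLpNorm (fun ω => A δ (n s ω - o ω)) (.ofReal q) μ) +
        eLpNorm (fun ω => A δ (E s (ξ ω - ζ ω))) (.ofReal q) μ := by
        refine (hadd _ _ ((((hg1.add hg2).add hg3).add hg4).neg.add hg5) hg6).trans ?_
        gcongr
        refine (hadd _ _ (((hg1.add hg2).add hg3).add hg4).neg hg5).trans ?_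
        gcongr
        refine (hneg _).trans_le ?_
        refine (hadd _ _ ((hg1.add hg2).add hg3) hg4).trans ?_
        gcongr
        refine (hadd _ _ (hg1.add hg2) hg3).trans ?_
        gcongr
        exact hadd _ _ hg1 hg2
    _ ≤ ((((M * (.ofReal (mesh ^ (γ - δ)) * eLpNorm (fun ω => A γ (ξ ω)) (.ofReal q) μ) +
        M * (.ofReal (mesh ^ r) *
          ⨆ u ∈ Icc 0 T, eLpNorm (fun ω => f (y u ω)) (.ofReal q) μ)) +
        M * (.ofReal (mesh ^ (1 - δ)) * eLpNorm (fun ω => f (y (lfl s) ω)) (.ofReal q) μ)) +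
        M * eLpNorm (fun ω => A δ (n s ω - n (lfl s) ω)) (.ofReal q) μ) +
        M * eLpNorm (fun ω => A δ (n s ω - o ω)) (.ofReal q) μ) +
        M * eLpNorm (fun ω => A δ (ξ ω - ζ ω)) (.ofReal q) μ := by
        have hle : ∀ x : ℝ≥0∞, x ≤ M * x := fun x => le_mul_of_one_le_left zero_le hM
        gcongr
        · exact b1.trans (hle _)
        · exact b3.trans (hle _)
        · exact hle _
        · exact hle _
        · exact b6.trans (hle _)
    _ = _ := by ring

lemma IsGridFloor.eLpNorm_residual_le [IsProbabilityMeasure μ] (h : IsGridFloor θ T mesh lfl)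
    (hlam : ∀ i, lam i < 0) (hf : Measurable f) (hξ : Measurable ξ)
    (hn : ∀ t ∈ Icc 0 T, Measurable (n t))
    (hy : ∀ t ∈ Icc 0 T, ∀ ω, y t ω = diagonalExp b lam t (ξ ω)
      + (∫ u in (0 : ℝ)..t, diagonalExp b lam (t - lfl u) (f (y (lfl u) ω))) + n t ω)
    {F : H → H} (hF : Continuous F) {C c κ : ℝ} (hC : 1 ≤ C) (hc : 1 ≤ c)
    {s γ δ r p : ℝ}
    (hFlip : ∀ x z : H, ‖F x - F z‖ ≤ C * ‖diagonalRpow b lam δ (x - z)‖ *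
      (1 + ‖diagonalRpow b lam κ x‖ ^ c + ‖diagonalRpow b lam κ z‖ ^ c))
    {o ζ : Ω → H} (ho : Measurable o) (hζ : Measurable ζ) (hs : s ∈ Ioc 0 T)
    (hδ : 0 ≤ δ) (hδγ : δ ≤ γ) (hγ : γ < 1) (hr : 0 ≤ r) (hδr : δ + r < 1) (hp : 1 ≤ p) :
    eLpNorm (fun ω => diagonalExp b lam (s - lfl s) (f (y (lfl s) ω))
        - F (y s ω - n s ω + o ω + diagonalExp b lam s (ζ ω - ξ ω))) (.ofReal (2 * p)) μ
      ≤ .ofReal (C * max T 1 / (1 - δ - r)) *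
        (.ofReal (mesh ^ (γ - δ)) *
          eLpNorm (fun ω => diagonalRpow b lam (γ - δ) (f (y (lfl s) ω))) (.ofReal (2 * p)) μ +
        eLpNorm (fun ω => f (y (lfl s) ω) - F (y (lfl s) ω)) (.ofReal (2 * p)) μ +
        (.ofReal (mesh ^ (1 - δ)) * eLpNorm (fun ω => f (y (lfl s) ω)) (.ofReal (4 * p)) μ +
          .ofReal (mesh ^ r) * (⨆ u ∈ Icc 0 T, eLpNorm (fun ω => f (y u ω)) (.ofReal (4 * p)) μ) +
          eLpNorm (fun ω => diagonalRpow b lam δ (n s ω - n (lfl s) ω)) (.ofReal (4 * p)) μ +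
          .ofReal (mesh ^ (γ - δ)) *
            eLpNorm (fun ω => diagonalRpow b lam γ (ξ ω)) (.ofReal (4 * p)) μ +
          eLpNorm (fun ω => diagonalRpow b lam δ (n s ω - o ω)) (.ofReal (4 * p)) μ +
          eLpNorm (fun ω => diagonalRpow b lam δ (ξ ω - ζ ω)) (.ofReal (4 * p)) μ) *
        (1 + eLpNorm (fun ω => diagonalRpow b lam κ (y (lfl s) ω)) (.ofReal (4 * p * c)) μ +
          eLpNorm (fun ω => diagonalRpow b lam κ (y s ω)) (.ofReal (4 * p * c)) μ +
          eLpNorm (fun ω => diagonalRpow b lam κ (n s ω - o ω)) (.ofReal (4 * p * c)) μ +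
          eLpNorm (fun ω => diagonalRpow b lam κ (ξ ω - ζ ω)) (.ofReal (4 * p * c)) μ) ^ c) := by
  have hdiff := h.eLpNorm_diagonalRpow_sub_le (μ := μ) (q := 4 * p) hlam hf hξ hn hy ho hζ hs hδ
    hδγ hγ hr hδr (by linarith)
  have hl := h.floor_mem_Icc hs.1
  have hsT : s ∈ Icc 0 T := ⟨hs.1.le, hs.2⟩
  have hsl : 0 < s - lfl s := by linarith [h.floor_lt hs.1]
  have hym : ∀ t ∈ Icc 0 T, Measurable (y t) := fun t ht => h.measurable_scheme hf hξ hn hy ht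
  set A := diagonalRpow b lam
  set E := diagonalExp b lam
  set G := ENNReal.ofReal (mesh ^ (1 - δ)) * eLpNorm (fun ω => f (y (lfl s) ω)) (.ofReal (4 * p)) μ +
    .ofReal (mesh ^ r) * (⨆ u ∈ Icc 0 T, eLpNorm (fun ω => f (y u ω)) (.ofReal (4 * p)) μ) +
    eLpNorm (fun ω => A δ (n s ω - n (lfl s) ω)) (.ofReal (4 * p)) μ +
    .ofReal (mesh ^ (γ - δ)) * eLpNorm (fun ω => A γ (ξ ω)) (.ofReal (4 * p)) μ +
    eLpNorm (fun ω => A δ (n s ω - o ω)) (.ofReal (4 * p)) μ +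
    eLpNorm (fun ω => A δ (ξ ω - ζ ω)) (.ofReal (4 * p)) μ
  set M := ENNReal.ofReal (max T 1 / (1 - (δ + r))) with hMdef
  have hM : 1 ≤ M := by
    rw [ENNReal.one_le_ofReal, le_div_iff₀ (by linarith)]
    linarith [le_max_right T 1]
  have hCM : ENNReal.ofReal (C * max T 1 / (1 - δ - r)) = .ofReal C * M := by
    rw [hMdef, ← ENNReal.ofReal_mul (by linarith), mul_div_assoc, sub_sub]
  have hC1 : 1 ≤ ENNReal.ofReal C := ENNReal.one_le_ofReal.2 hC
  have hEm : ∀ t, Measurable (E t) := fun t => (E t).continuous.measurable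
  have hAm : ∀ t, Measurable (A t) := fun t => (A t).continuous.measurable
  have hfm : Measurable fun ω => f (y (lfl s) ω) := hf.comp (hym _ hl)
  set Y : Ω → H := fun ω => y s ω - n s ω + o ω + E s (ζ ω - ξ ω) with hY
  have hYm : Measurable Y :=
    (((hym _ hsT).sub (hn _ hsT)).add ho).add ((hEm s).comp (hζ.sub hξ))
  have r1 : eLpNorm (fun ω => E (s - lfl s) (f (y (lfl s) ω)) - f (y (lfl s) ω))
      (.ofReal (2 * p)) μ ≤ .ofReal (mesh ^ (γ - δ)) *
        eLpNorm (fun ω => A (γ - δ) (f (y (lfl s) ω))) (.ofReal (2 * p)) μ :=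
    eLpNorm_mono_mul (Real.rpow_le_rpow hsl.le (h.sub_floor_le hs) (by linarith)) (fun ω =>
      norm_diagonalExp_sub_le hlam hsl.le (by linarith) (by linarith) _) _
  have hκ : eLpNorm (fun ω => A κ (Y ω)) (.ofReal (4 * p * c)) μ
      ≤ eLpNorm (fun ω => A κ (y s ω)) (.ofReal (4 * p * c)) μ +
        eLpNorm (fun ω => A κ (n s ω - o ω)) (.ofReal (4 * p * c)) μ +
        eLpNorm (fun ω => A κ (ξ ω - ζ ω)) (.ofReal (4 * p * c)) μ := by
    have hq1 : 1 ≤ ENNReal.ofReal (4 * p * c) := by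
      rw [ENNReal.one_le_ofReal]; nlinarith
    have hYeq : (fun ω => A κ (Y ω))
        = (fun ω => A κ (y s ω)) - (fun ω => A κ (n s ω - o ω))
          - fun ω => A κ (E s (ξ ω - ζ ω)) := by
      ext1 ω
      simp only [hY, Pi.sub_apply, ← map_sub]
      rw [← neg_sub (ξ ω) (ζ ω), map_neg (E s)]
      congr 1; abel
    have m1 : AEStronglyMeasurable (fun ω => A κ (y s ω)) μ :=
      ((hAm κ).comp (hym _ hsT)).aestronglyMeasurable
    have m2 : AEStronglyMeasurable (fun ω => A κ (n s ω - o ω)) μ :=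
      ((hAm κ).comp ((hn _ hsT).sub ho)).aestronglyMeasurable
    have m3 : AEStronglyMeasurable (fun ω => A κ (E s (ξ ω - ζ ω))) μ :=
      ((hAm κ).comp ((hEm s).comp (hξ.sub hζ))).aestronglyMeasurable
    rw [hYeq]
    refine (eLpNorm_sub_le (m1.sub m2) m3 hq1).trans ?_
    gcongr
    · exact eLpNorm_sub_le m1 m2 hq1
    · exact eLpNorm_mono fun ω => norm_diagonalRpow_diagonalExp_le hlam hs.1.le κ _
  have r3 : eLpNorm (fun ω => F (y (lfl s) ω) - F (Y ω)) (.ofReal (2 * p)) μ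
      ≤ .ofReal C * (M * G * (1 + eLpNorm (fun ω => A κ (y (lfl s) ω)) (.ofReal (4 * p * c)) μ +
          eLpNorm (fun ω => A κ (y s ω)) (.ofReal (4 * p * c)) μ +
          eLpNorm (fun ω => A κ (n s ω - o ω)) (.ofReal (4 * p * c)) μ +
          eLpNorm (fun ω => A κ (ξ ω - ζ ω)) (.ofReal (4 * p * c)) μ) ^ c) := by
    have h4 : 2 * (2 * p) = 4 * p := by ring
    refine (eLpNorm_le_of_lipschitz_growth (by linarith) hc (by linarith)
      ((hAm δ).comp ((hym _ hl).sub hYm)).aestronglyMeasurable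
      ((hAm κ).comp (hym _ hl)).aestronglyMeasurable
      ((hAm κ).comp hYm).aestronglyMeasurable
      fun ω => hFlip (y (lfl s) ω) (Y ω)).trans ?_
    rw [h4]
    refine mul_le_mul_right (mul_le_mul' hdiff (ENNReal.rpow_le_rpow ?_ (by linarith))) _
    refine (add_le_add_right hκ _).trans_eq ?_
    simp only [add_assoc]
    rfl
  have m1 : AEStronglyMeasurable
      (fun ω => E (s - lfl s) (f (y (lfl s) ω)) - f (y (lfl s) ω)) μ :=
    (((hEm _).comp hfm).sub hfm).aestronglyMeasurable
  have m2 : AEStronglyMeasurable (fun ω => f (y (lfl s) ω) - F (y (lfl s) ω)) μ :=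
    (hfm.sub (hF.measurable.comp (hym _ hl))).aestronglyMeasurable
  have m3 : AEStronglyMeasurable (fun ω => F (y (lfl s) ω) - F (Y ω)) μ :=
    ((hF.measurable.comp (hym _ hl)).sub (hF.measurable.comp hYm)).aestronglyMeasurable
  have hq1 : 1 ≤ ENNReal.ofReal (2 * p) := by rw [ENNReal.one_le_ofReal]; linarith
  have hR : (fun ω => E (s - lfl s) (f (y (lfl s) ω)) - F (Y ω))
      = ((fun ω => E (s - lfl s) (f (y (lfl s) ω)) - f (y (lfl s) ω))
        + fun ω => f (y (lfl s) ω) - F (y (lfl s) ω)) + fun ω => F (y (lfl s) ω) - F (Y ω) := by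
    ext1 ω
    simp only [Pi.add_apply]; abel
  have hle : ∀ x : ℝ≥0∞, x ≤ .ofReal C * M * x := fun x =>
    le_mul_of_one_le_left zero_le (one_le_mul hC1 hM)
  rw [hR, hCM, mul_add, mul_add]
  refine (eLpNorm_add_le (m1.add m2) m3 hq1).trans (add_le_add
    ((eLpNorm_add_le m1 m2 hq1).trans (add_le_add (r1.trans (hle _)) (hle _)))
    (r3.trans_eq ?_))
  ring

end SchemeMoments

/-- Strong `L^p` error estimate: in the probabilistic setting with flows
`X_{s,t}^x(ω)`, numerical approximation `𝕪`, noise processes `O, 𝕆`, grid `θ` with mesh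
`|θ|_T = mesh` and floor `lfl`, constants `C, c, p ∈ [1,∞)`, `γ ∈ [0,1)`, `δ ∈ [0,γ]`,
`iota ∈ [0,1−δ)`, `κ ∈ ℝ`, fractional powers `Ap r = (−A)^r`, and with
`‖V‖_{L^q(ℙ;E)} = (E[‖V‖_E^q])^{1/q} ∈ [0,∞]` formalized by `eLpNorm`: for every
measurable `ζ : Ω → H` and `t ∈ [0,T]` the stated inequality holds. -/
theorem stmt_6
    {H : Type*} [NormedAddCommGroup H] [InnerProductSpace ℝ H]
    [FiniteDimensional ℝ H] [Nontrivial H] [MeasurableSpace H] [BorelSpace H]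
    {ι : Type*} [Fintype ι] (b : OrthonormalBasis ι ℝ H)
    (lam : ι → ℝ) (hlam : ∀ i, lam i < 0)
    (E : ℝ → H → H)
    (hE : ∀ t v, E t v = ∑ i, (Real.exp (t * lam i) * ⟪b i, v⟫) • b i)
    (Ap : ℝ → H → H)
    (hAp : ∀ r v, Ap r v = ∑ i, (((-lam i) ^ r) * ⟪b i, v⟫) • b i)
    {Ω : Type*} [MeasurableSpace Ω] (Pr : Measure Ω) [IsProbabilityMeasure Pr]
    (T : ℝ) (hT : 0 < T)
    (θ : Finset ℝ) (hθ0 : (0 : ℝ) ∈ θ) (hθT : T ∈ θ)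
    (hθsub : ∀ x ∈ θ, x ∈ Set.Icc (0 : ℝ) T)
    (mesh : ℝ)
    (hmesh : IsGreatest
      {x : ℝ | 0 < x ∧ ∃ a ∈ θ, ∃ e ∈ θ, x = e - a ∧ ∀ z ∈ θ, ¬(a < z ∧ z < e)} mesh)
    (lfl : ℝ → ℝ) (hlfl0 : lfl 0 = 0)
    (hlfl : ∀ t : ℝ, 0 < t → IsGreatest {x : ℝ | x ∈ θ ∧ x < t} (lfl t))
    (C c p γ δ iota κ : ℝ)
    (hC : 1 ≤ C) (hc : 1 ≤ c) (hp : 1 ≤ p)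
    (hγ : 0 ≤ γ ∧ γ < 1) (hδ : δ ∈ Set.Icc 0 γ)
    (hiota : 0 ≤ iota ∧ iota < 1 - δ)
    (ξ : Ω → H) (hξ : Measurable ξ)
    (F : H → H) (hF : ContDiff ℝ 1 F)
    (hFlip : ∀ x z : H,
      ‖F x - F z‖ ≤ C * ‖Ap δ (x - z)‖ * (1 + ‖Ap κ x‖ ^ c + ‖Ap κ z‖ ^ c))
    (f : H → H) (hf : Measurable f)
    (OO : ℝ → Ω → H)
    (hOO : Measurable fun q : Set.Icc (0 : ℝ) T × Ω => OO (↑q.1) q.2)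
    (O : ℝ → Ω → H)
    (hOmeas : ∀ t, Measurable fun ω => O t ω)
    (hOcont : ∀ ω, ContinuousOn (fun t => O t ω) (Set.Icc (0 : ℝ) T))
    (X : ℝ → ℝ → H → Ω → H)
    (hXmeas : ∀ s t x, Measurable fun ω => X s t x ω)
    (hXcont : ∀ s ∈ Set.Icc (0 : ℝ) T, ∀ x : H, ∀ ω,
      ContinuousOn (fun t => X s t x ω) (Set.Icc s T))
    (hXeq : ∀ s ∈ Set.Icc (0 : ℝ) T, ∀ x : H, ∀ t ∈ Set.Icc s T, ∀ ω,
      X s t x ω = E (t - s) x + (∫ u in s..t, E (t - u) (F (X s u x ω))) + O t ω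
        - E (t - s) (O s ω))
    (y : ℝ → Ω → H)
    (hy : ∀ t ∈ Set.Icc (0 : ℝ) T, ∀ ω,
      y t ω = E t (ξ ω) + (∫ u in (0 : ℝ)..t, E (t - lfl u) (f (y (lfl u) ω))) + OO t ω) :
    ∀ ζ : Ω → H, Measurable ζ → ∀ t ∈ Set.Icc (0 : ℝ) T,
      eLpNorm (fun ω => y t ω - X 0 t (ζ ω + O 0 ω) ω) (ENNReal.ofReal p) Pr ≤
        eLpNorm (fun ω => OO t ω - O t ω) (ENNReal.ofReal p) Pr +
        eLpNorm (fun ω => ξ ω - ζ ω) (ENNReal.ofReal p) Pr +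
        ENNReal.ofReal (C * max T 1 / (1 - δ - iota)) *
          ∫⁻ s in Set.Icc (0 : ℝ) t,
            (eLpNorm (fun ω => fderiv ℝ (fun z => X s t z ω)
                (y s ω - OO s ω + O s ω + E s (ζ ω - ξ ω))) (ENNReal.ofReal (2 * p)) Pr) *
            ( ENNReal.ofReal (mesh ^ (γ - δ)) *
                eLpNorm (fun ω => Ap (γ - δ) (f (y (lfl s) ω))) (ENNReal.ofReal (2 * p)) Pr +
              eLpNorm (fun ω => f (y (lfl s) ω) - F (y (lfl s) ω))
                (ENNReal.ofReal (2 * p)) Pr +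
              ( ENNReal.ofReal (mesh ^ (1 - δ)) *
                  eLpNorm (fun ω => f (y (lfl s) ω)) (ENNReal.ofReal (4 * p)) Pr +
                ENNReal.ofReal (mesh ^ iota) *
                  (⨆ u ∈ Set.Icc (0 : ℝ) T,
                    eLpNorm (fun ω => f (y u ω)) (ENNReal.ofReal (4 * p)) Pr) +
                eLpNorm (fun ω => Ap δ (OO s ω - OO (lfl s) ω))
                  (ENNReal.ofReal (4 * p)) Pr +
                ENNReal.ofReal (mesh ^ (γ - δ)) *
                  eLpNorm (fun ω => Ap γ (ξ ω)) (ENNReal.ofReal (4 * p)) Pr +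
                eLpNorm (fun ω => Ap δ (OO s ω - O s ω)) (ENNReal.ofReal (4 * p)) Pr +
                eLpNorm (fun ω => Ap δ (ξ ω - ζ ω)) (ENNReal.ofReal (4 * p)) Pr ) *
              ( 1 +
                eLpNorm (fun ω => Ap κ (y (lfl s) ω)) (ENNReal.ofReal (4 * p * c)) Pr +
                eLpNorm (fun ω => Ap κ (y s ω)) (ENNReal.ofReal (4 * p * c)) Pr +
                eLpNorm (fun ω => Ap κ (OO s ω - O s ω)) (ENNReal.ofReal (4 * p * c)) Pr +
                eLpNorm (fun ω => Ap κ (ξ ω - ζ ω)) (ENNReal.ofReal (4 * p * c)) Pr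
              ) ^ c ) := by
  intro ζ hζ t ht
  have h : IsGridFloor θ T mesh lfl := ⟨hθ0, hθT, hθsub, hmesh, hlfl⟩
  have hEeq : E = fun t v => diagonalExp b lam t v := by
    ext1 t; ext1 v
    rw [hE, diagonalExp, diagonalCLM_apply]
  have hAeq : Ap = fun r v => diagonalRpow b lam r v := by
    ext1 r; ext1 v
    rw [hAp, diagonalRpow, diagonalCLM_apply]
  clear hE hAp
  subst hEeq hAeq
  beta_reduce at *
  set S := diagonalExp b lam
  have hflow : ∀ ω, IsMildFlow S F (fun t => O t ω) (fun s t x => X s t x ω) T := fun ω =>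
    { continuous_group := continuous_diagonalExp b lam
      group_zero := diagonalExp_zero b lam
      group_add := diagonalExp_add b lam
      contDiff := hF
      continuousOn_noise := hOcont ω
      continuousOn := fun s hs x => hXcont s hs x ω
      eq_integral := fun s hs x r hr => hXeq s hs x r hr ω }
  have hn : ∀ s ∈ Icc 0 T, Measurable (OO s) := fun s hs =>
    hOO.comp (measurable_const (a := (⟨s, hs⟩ : Icc (0 : ℝ) T)) |>.prodMk measurable_id)
  have hym : ∀ s ∈ Icc 0 T, Measurable (y s) := fun s hs => h.measurable_scheme hf hξ hn hy hs
  have hSm : ∀ s, Measurable (S s) := fun s => (S s).continuous.measurable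
  have htT : ∀ s ∈ Icc 0 t, s ∈ Icc 0 T := fun s hs => ⟨hs.1, hs.2.trans ht.2⟩
  set Y : ℝ → Ω → H := fun s ω => y s ω - OO s ω + O s ω + S s (ζ ω - ξ ω) with hY
  have hYm : ∀ s ∈ Icc 0 T, Measurable (Y s) := fun s hs =>
    (((hym s hs).sub (hn s hs)).add (hOmeas s)).add ((hSm s).comp (hζ.sub hξ))
  set P : ℝ → Ω → H := fun s ω => ζ ω + ∫ u in (0 : ℝ)..s, S (-lfl u) (f (y (lfl u) ω)) with hP
  have hYP : ∀ s ∈ Icc 0 T, ∀ ω, Y s ω = S s (P s ω) + O s ω := fun s hs ω => by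
    simp only [hY, hP]
    rw [h.scheme_eq (diagonalExp_add b lam) (x := ξ ω) (y := fun t => y t ω) (n := fun t => OO t ω)
      (fun t ht => hy t ht ω) hs]
    simp only [map_add, map_sub]
    abel
  set φ : ℝ → Ω → H := fun s ω => X s t (Y s ω) ω with hφ
  have hφP : ∀ ω, ∀ s ∈ Icc 0 t, φ s ω = X s t (S s (P s ω) + O s ω) ω := fun ω s hs => by
    simp only [hφ, hYP s (htT s hs)]
  set R : ℝ → Ω → H := fun s ω => S (s - lfl s) (f (y (lfl s) ω)) - F (Y s ω) with hR
  have hPd : ∀ ω, ∀ s ∈ Ioc 0 t,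
      HasDerivWithinAt (fun s => P s ω) (S (-lfl s) (f (y (lfl s) ω))) (Iic s) s := fun ω s hs =>
    (h.hasDerivWithinAt_integral (fun a => S (-a) (f (y a ω))) hs.1).const_add _
  have hcont : ∀ ω, ContinuousOn (fun s => φ s ω) (Icc 0 t) := fun ω =>
    ((hflow ω).continuousOn_comp ht.1 ht.2 (continuousOn_const.add
      (h.continuousOn_integral (fun a => S (-a) (f (y a ω))) ht.1)) (hPd ω)).congr (hφP ω)
  have hder : ∀ ω, ∀ s ∈ Ioc 0 t, HasDerivWithinAt (fun s => φ s ω)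
      (fderiv ℝ (fun z => X s t z ω) (Y s ω) (R s ω)) (Iic s) s := fun ω s hs => by
    have hsI : s ∈ Icc 0 t := ⟨hs.1.le, hs.2⟩
    have := (hflow ω).hasDerivWithinAt_comp hs.1 hs.2 ht.2 (hPd ω s hs)
    rw [← hYP s (htT s hsI), ← (hflow ω).group_add, ← sub_eq_add_neg] at this
    refine this.congr_of_eventuallyEq ?_ (hφP ω s hsI)
    filter_upwards [Ioc_mem_nhdsLE hs.1] with u hu
    exact hφP ω u ⟨hu.1.le, hu.2.trans hs.2⟩
  have hXd : ∀ s ∈ Icc 0 t, ∀ ω, Differentiable ℝ fun z => X s t z ω := fun s hs ω =>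
    (hflow ω).differentiableAt hs.1 hs.2 ht.2
  have hφm : ∀ s ∈ Icc 0 t, Measurable (φ s) := fun s hs =>
    (hYm s (htT s hs)).apply_of_continuous (hXmeas s t) fun ω => (hXd s hs ω).continuous
  have hp1 : 1 ≤ ENNReal.ofReal p := ENNReal.one_le_ofReal.2 hp
  have hdecomp : (fun ω => y t ω - X 0 t (ζ ω + O 0 ω) ω)
      = ((fun ω => OO t ω - O t ω) + fun ω => S t (ξ ω - ζ ω)) + fun ω => φ t ω - φ 0 ω := by
    ext1 ω
    have h0 : Y 0 ω = ζ ω + O 0 ω := by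
      rw [hYP 0 ⟨le_rfl, hT.le⟩]
      simp [hP, S, diagonalExp_zero]
    have h1 : φ t ω = Y t ω := (hflow ω).apply_self ht _
    have h2 : φ 0 ω = X 0 t (ζ ω + O 0 ω) ω := by simp only [hφ, h0]
    simp only [Pi.add_apply, h1, h2, hY, map_sub]
    abel
  have m1 : AEStronglyMeasurable (fun ω => OO t ω - O t ω) Pr :=
    ((hn t ht).sub (hOmeas t)).aestronglyMeasurable
  have m2 : AEStronglyMeasurable (fun ω => S t (ξ ω - ζ ω)) Pr :=
    ((hSm t).comp (hξ.sub hζ)).aestronglyMeasurable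
  have m3 : AEStronglyMeasurable (fun ω => φ t ω - φ 0 ω) Pr :=
    ((hφm t ⟨ht.1, le_rfl⟩).sub (hφm 0 ⟨le_rfl, ht.1⟩)).aestronglyMeasurable
  rw [hdecomp]
  refine (eLpNorm_add_le (m1.add m2) m3 hp1).trans (add_le_add
    ((eLpNorm_add_le m1 m2 hp1).trans (add_le_add_right ?_ _)) ?_)
  · exact eLpNorm_mono fun ω => norm_diagonalExp_le hlam ht.1 _
  refine (eLpNorm_sub_le_lintegral_of_hasDerivWithinAt_Iic ht.1 hp hφm hcont hder).trans ?_
  rw [← lintegral_const_mul' _ _ ENNReal.ofReal_ne_top]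
  refine (setLIntegral_mono' measurableSet_Ioc fun s hs => ?_).trans
    (lintegral_mono_set Ioc_subset_Icc_self)
  have hsI : s ∈ Icc 0 t := ⟨hs.1.le, hs.2⟩
  have hsT : s ∈ Ioc 0 T := ⟨hs.1, hs.2.trans ht.2⟩
  have hRm : Measurable (R s) := ((hSm _).comp (hf.comp (hym _ (h.floor_mem_Icc hs.1)))).sub
    (hF.continuous.measurable.comp (hYm s (htT s hsI)))
  have hDm : StronglyMeasurable fun ω => fderiv ℝ (fun z => X s t z ω) (Y s ω) :=
    StronglyMeasurable.clm_of_apply fun v =>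
      ((hYm s (htT s hsI)).fderiv_apply_of_differentiable (hXmeas s t) (hXd s hsI)
        v).stronglyMeasurable
  refine (eLpNorm_clm_apply_le p hDm.aestronglyMeasurable hRm.aestronglyMeasurable).trans ?_
  rw [mul_left_comm]
  exact mul_le_mul_right (h.eLpNorm_residual_le hlam hf hξ hn hy hF.continuous hC hc hFlip
    (hOmeas s) hζ hsT hδ.1 hδ.2 hγ.2 hiota.1 (by linarith [hiota.2]) hp) _
end

section
/- With Δ_T = {(u,v) ∈ [0,T]² : u ≤ v}: (i) the map Δ_T × H ∋ (s,t,x) ↦ 𝒳_{s,t}^x ∈ H is of class C^{0,0,1}; (ii) for all s ∈ [0,T], t ∈ [s,T], x, y ∈ H it holds that (∂_x 𝒳_{s,t}^x) y = y + ∫_s^t [ A (∂_x 𝒳_{s,u}^x) y + F′(𝒳_{s,u}^x + O_u) (∂_x 𝒳_{s,u}^x) y ] du; and (iii) for all s ∈ [0,T], t ∈ [s,T], x ∈ H it holds that ‖∂_x 𝒳_{s,t}^x‖_{L(H)} ≤ exp( ∫_s^t ( ε ‖𝒳_{s,u}^x + O_u‖_{H_{1/2}}² + C ) du ), where ∂_x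 𝒳_{s,t}^x ∈ L(H) denotes the Fréchet derivative of x ↦ 𝒳_{s,t}^x. -/
open MeasureTheory Set
open scoped ENNReal RealInnerProductSpace NNReal

open Filter Topology

/-- The time-one values of solutions of a family of locally Lipschitz ODEs on `[0, 1]` depend
continuously on the parameter when the vector fields and the initial values do. -/
theorem continuous_ode_solution_one {P E : Type*} [TopologicalSpace P] [NormedAddCommGroup E]
    [NormedSpace ℝ E] [ProperSpace E] {f : P → ℝ → E → E} {Z : P → ℝ → E}
    (hf : Continuous fun q : P × ℝ × E => f q.1 q.2.1 q.2.2)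
    (hlip : ∀ p R, ∃ L, ∀ τ ∈ Icc (0 : ℝ) 1, ∀ v w : E, ‖v‖ ≤ R → ‖w‖ ≤ R →
      ‖f p τ v - f p τ w‖ ≤ L * ‖v - w‖)
    (hZ₀ : Continuous fun p => Z p 0)
    (hZ : ∀ p, ∀ τ ∈ Icc (0 : ℝ) 1, HasDerivWithinAt (Z p) (f p τ (Z p τ)) (Icc 0 1) τ) :
    Continuous fun p => Z p 1 := by
  have hc : ∀ p, ContinuousOn (Z p) (Icc 0 1) := fun p τ hτ => (hZ p τ hτ).continuousWithinAt
  have hr : ∀ p, ∀ τ ∈ Ico (0 : ℝ) 1, HasDerivWithinAt (Z p) (f p τ (Z p τ)) (Ici τ) τ :=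
    fun p τ hτ => (hZ p τ (Ico_subset_Icc_self hτ)).mono_of_mem_nhdsWithin
      (Icc_mem_nhdsGE_of_mem hτ)
  refine continuous_iff_continuousAt.2 fun p₀ => Metric.tendsto_nhds.2 fun ε hε => ?_
  obtain ⟨R, hR⟩ := isCompact_Icc.exists_bound_of_continuousOn (hc p₀)
  obtain ⟨L₀, hL₀⟩ := hlip p₀ (R + 1)
  obtain ⟨L, hL, hL0⟩ : ∃ L, (∀ τ ∈ Icc (0 : ℝ) 1, ∀ v w : E, ‖v‖ ≤ R + 1 → ‖w‖ ≤ R + 1 →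
      ‖f p₀ τ v - f p₀ τ w‖ ≤ L * ‖v - w‖) ∧ 0 ≤ L :=
    ⟨max L₀ 0, fun τ hτ v w hv hw => (hL₀ τ hτ v w hv hw).trans (by gcongr; exact le_max_left _ _),
      le_max_right _ _⟩
  obtain ⟨η, hη, hη'⟩ : ∃ η > 0, η * Real.exp (L + 2) = min (ε / 2) 1 :=
    ⟨min (ε / 2) 1 * Real.exp (-(L + 2)), by positivity, by
      rw [mul_assoc, ← Real.exp_add, neg_add_cancel, Real.exp_zero, mul_one]⟩
  have h₁ : ∀ᶠ p in 𝓝 p₀, ‖Z p 0 - Z p₀ 0‖ < η := by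
    simpa only [dist_eq_norm] using Metric.tendsto_nhds.1 (hZ₀.tendsto p₀) η hη
  have h₂ : ∀ᶠ p in 𝓝 p₀, ∀ y ∈ Icc (0 : ℝ) 1 ×ˢ Metric.closedBall (0 : E) (R + 1),
      ‖f p y.1 y.2 - f p₀ y.1 y.2‖ < η := by
    refine (isCompact_Icc.prod
      (isCompact_closedBall (0 : E) (R + 1))).eventually_forall_of_forall_eventually
      (P := fun p y => ‖f p y.1 y.2 - f p₀ y.1 y.2‖ < η) fun y _ => ?_
    have : Continuous fun z : P × ℝ × E => ‖f z.1 z.2.1 z.2.2 - f p₀ z.2.1 z.2.2‖ :=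
      (hf.sub (hf.comp (continuous_const.prodMk continuous_snd))).norm
    exact this.continuousAt.eventually_lt continuousAt_const (by simpa using hη)
  filter_upwards [h₁, h₂] with p hp₁ hp₂
  have hB : ∀ τ : ℝ, HasDerivAt (fun τ => η * Real.exp ((L + 2) * τ))
      ((L + 2) * (η * Real.exp ((L + 2) * τ))) τ := fun τ => by
    have := (((hasDerivAt_id τ).const_mul (L + 2)).exp).const_mul η
    refine this.congr_deriv ?_
    simp only [id]
    ring
  have key := image_norm_le_of_norm_deriv_right_lt_deriv_boundary
    (f := fun τ => Z p τ - Z p₀ τ) ((hc p).sub (hc p₀))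
    (fun τ hτ => (hr p τ hτ).sub (hr p₀ τ hτ)) (by simpa using hp₁.le) hB
    (fun τ hτ hb => ?_) (right_mem_Icc.2 zero_le_one)
  · rw [dist_eq_norm]
    simp only [mul_one, hη'] at key
    linarith [min_le_left (ε / 2) 1]
  · have hτ' := Ico_subset_Icc_self hτ
    have hle : η * Real.exp ((L + 2) * τ) ≤ 1 := by
      calc η * Real.exp ((L + 2) * τ) ≤ η * Real.exp ((L + 2) * 1) := by gcongr; exact hτ.2.le
        _ ≤ 1 := by rw [mul_one, hη']; exact min_le_right _ _
    have hηle : η ≤ η * Real.exp ((L + 2) * τ) :=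
      le_mul_of_one_le_right hη.le (Real.one_le_exp (mul_nonneg (by linarith) hτ.1))
    have hZp₀ : ‖Z p₀ τ‖ ≤ R + 1 := (hR τ hτ').trans (by linarith)
    have hZp : ‖Z p τ‖ ≤ R + 1 := by
      calc ‖Z p τ‖ = ‖Z p₀ τ + (Z p τ - Z p₀ τ)‖ := by rw [add_sub_cancel]
        _ ≤ R + 1 := (norm_add_le _ _).trans (add_le_add (hR τ hτ') (hb ▸ hle))
    have h3 := hp₂ (τ, Z p τ) ⟨hτ', by simpa using hZp⟩
    have h4 := hL τ hτ' _ _ hZp hZp₀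
    rw [hb] at h4
    calc ‖f p τ (Z p τ) - f p₀ τ (Z p₀ τ)‖
        = ‖(f p τ (Z p τ) - f p₀ τ (Z p τ)) + (f p₀ τ (Z p τ) - f p₀ τ (Z p₀ τ))‖ := by
          rw [sub_add_sub_cancel]
      _ ≤ _ := norm_add_le _ _
      _ < (L + 2) * (η * Real.exp ((L + 2) * τ)) := by simp only at h3; linarith

/-- Joint continuity in the parameter and in time of a family of solutions of ODEs whose initial
times are allowed to vary with the parameter. -/
theorem continuousOn_ode_solution {Q E : Type*} [TopologicalSpace Q] [NormedAddCommGroup E]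
    [NormedSpace ℝ E] [ProperSpace E] {T : ℝ} {σ : Q → ℝ} {g : Q → ℝ → E → E} {Z : Q → ℝ → E}
    (hσ : Continuous σ)
    (hg : Continuous fun q : Q × ℝ × E => g q.1 q.2.1 q.2.2)
    (hlip : ∀ q R, ∃ L, ∀ u ∈ Icc (σ q) T, ∀ v w : E, ‖v‖ ≤ R → ‖w‖ ≤ R →
      ‖g q u v - g q u w‖ ≤ L * ‖v - w‖)
    (hZ₀ : Continuous fun q => Z q (σ q))
    (hZ : ∀ q, ∀ t ∈ Icc (σ q) T, HasDerivWithinAt (Z q) (g q t (Z q t)) (Icc (σ q) T) t) :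
    ContinuousOn (fun p : Q × ℝ => Z p.1 p.2) {p | σ p.1 ≤ p.2 ∧ p.2 ≤ T} := by
  rw [continuousOn_iff_continuous_domRestrict]
  have hmaps : ∀ p : {p : Q × ℝ | σ p.1 ≤ p.2 ∧ p.2 ≤ T}, MapsTo
      (fun τ => σ p.1.1 + τ * (p.1.2 - σ p.1.1)) (Icc 0 1) (Icc (σ p.1.1) T) := fun p τ hτ => by
    have h1 : 0 ≤ p.1.2 - σ p.1.1 := sub_nonneg.2 p.2.1
    have h2 : p.1.2 ≤ T := p.2.2
    exact ⟨le_add_of_nonneg_right (mul_nonneg hτ.1 h1), by nlinarith [hτ.2]⟩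
  have key := continuous_ode_solution_one
    (P := {p : Q × ℝ | σ p.1 ≤ p.2 ∧ p.2 ≤ T})
    (f := fun p τ v => (p.1.2 - σ p.1.1) • g p.1.1 (σ p.1.1 + τ * (p.1.2 - σ p.1.1)) v)
    (Z := fun p τ => Z p.1.1 (σ p.1.1 + τ * (p.1.2 - σ p.1.1))) ?_ ?_ ?_ ?_
  · refine key.congr fun p => ?_
    simp
  · refine Continuous.smul (by fun_prop) (hg.comp (f := fun q : {p : Q × ℝ | σ p.1 ≤ p.2 ∧ p.2 ≤ T}
      × ℝ × E => (q.1.1.1, σ q.1.1.1 + q.2.1 * (q.1.1.2 - σ q.1.1.1), q.2.2)) (by fun_prop))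
  · intro p R
    obtain ⟨L, hL⟩ := hlip p.1.1 R
    refine ⟨(p.1.2 - σ p.1.1) * L, fun τ hτ v w hv hw => ?_⟩
    have h1 : 0 ≤ p.1.2 - σ p.1.1 := sub_nonneg.2 p.2.1
    rw [← smul_sub, norm_smul, Real.norm_of_nonneg h1, mul_assoc]
    exact mul_le_mul_of_nonneg_left (hL _ (hmaps p hτ) v w hv hw) h1
  · simp only [zero_mul, add_zero]
    exact hZ₀.comp (continuous_fst.comp continuous_subtype_val)
  · intro p τ hτ
    refine (hZ p.1.1 _ (hmaps p hτ)).scomp τ ?_ (hmaps p)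
    simpa using (((hasDerivAt_id τ).mul_const (p.1.2 - σ p.1.1)).const_add
      (σ p.1.1)).hasDerivWithinAt

/-- Global existence for linear ODEs with continuous coefficients. -/
theorem exists_hasDerivWithinAt_linear {E : Type*} [NormedAddCommGroup E] [NormedSpace ℝ E]
    [FiniteDimensional ℝ E] {D : ℝ → E →L[ℝ] E} (hD : Continuous D) {a b : ℝ} (hab : a ≤ b)
    (x₀ : E) :
    ∃ Z : ℝ → E, Z a = x₀ ∧ ∀ t ∈ Icc a b, HasDerivWithinAt Z (D t (Z t)) (Icc a b) t := by
  obtain ⟨K, hK⟩ := isCompact_Icc.exists_bound_of_continuousOn (hD.continuousOn (s := Icc a b))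
  have hK0 : 0 ≤ K := (norm_nonneg _).trans (hK a (left_mem_Icc.2 hab))
  set N := ‖x₀‖ * Real.exp (K * (b - a)) + 1 with hN
  have hN0 : 0 < N := by positivity
  let χ : ContDiffBump (0 : E) := ⟨N, N + 1, hN0, by linarith⟩
  let ρ : E → E := fun v => χ v • v
  have hρ1 : ∀ v, ‖v‖ ≤ N → ρ v = v := fun v hv => by
    have : χ v = 1 := χ.one_of_mem_closedBall (by simpa using hv)
    simp [ρ, this]
  have hρ2 : ∀ v, ‖ρ v‖ ≤ ‖v‖ := fun v => by
    simp only [ρ, norm_smul, Real.norm_of_nonneg χ.nonneg]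
    exact mul_le_of_le_one_left (norm_nonneg _) χ.le_one
  have hρ3 : ∀ v, ‖ρ v‖ ≤ N + 1 := fun v => by
    by_cases hv : ‖v‖ ≤ N + 1
    · exact (hρ2 v).trans hv
    · have : χ v = 0 := χ.zero_of_le_dist (by simpa using (not_le.1 hv).le)
      simp only [ρ, this, zero_smul, norm_zero]
      linarith
  obtain ⟨C, hC⟩ : ∃ C, LipschitzWith C ρ :=
    ContDiff.lipschitzWith_of_hasCompactSupport (n := 1) (𝕂 := ℝ) χ.hasCompactSupport.smul_right
      (χ.contDiff.smul contDiff_id) one_ne_zero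
  have hP : IsPicardLindelof (fun t v => D t (ρ v)) (⟨a, left_mem_Icc.2 hab⟩ : Icc a b) x₀
      (K * (N + 1) * (b - a)).toNNReal 0 (K * (N + 1)).toNNReal (K.toNNReal * C) := by
    refine ⟨fun t ht => ?_, fun x _ => (hD.clm_apply continuous_const).continuousOn,
      fun t ht x _ => ?_, ?_⟩
    · refine (((D t).lipschitz.weaken ?_).comp hC).lipschitzOnWith
      exact NNReal.le_toNNReal_of_coe_le (hK t ht)
    · rw [Real.coe_toNNReal _ (by positivity)]
      exact (D t).le_of_opNorm_le_of_le (hK t ht) (hρ3 x)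
    · have := sub_nonneg.2 hab
      rw [Real.coe_toNNReal _ (by positivity), Real.coe_toNNReal _ (by positivity)]
      simp [this]
  obtain ⟨Z, hZa, hZ⟩ := hP.exists_eq_forall_mem_Icc_hasDerivWithinAt₀
  have hbd : ∀ t ∈ Icc a b, ‖Z t‖ ≤ N := fun t ht => by
    have := norm_le_gronwallBound_of_norm_deriv_right_le (K := K) (ε := 0)
      (fun t ht => (hZ t ht).continuousWithinAt)
      (fun t ht => (hZ t (Ico_subset_Icc_self ht)).mono_of_mem_nhdsWithin
        (Icc_mem_nhdsGE_of_mem ht)) (congrArg norm hZa).le (fun t ht => by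
          rw [add_zero]
          exact (D t).le_of_opNorm_le_of_le (hK t (Ico_subset_Icc_self ht)) (hρ2 _)) t ht
    rw [gronwallBound_ε0] at this
    calc ‖Z t‖ ≤ _ := this
      _ ≤ ‖x₀‖ * Real.exp (K * (b - a)) := by gcongr; exact ht.2
      _ ≤ N := by linarith
  exact ⟨Z, hZa, fun t ht => by simpa only [hρ1 _ (hbd t ht)] using hZ t ht⟩

/-- A map with continuous derivative is Lipschitz on balls, uniformly in a compact set of times. -/
theorem exists_lipschitz_bound_of_continuous_deriv {E G : Type*} [NormedAddCommGroup E]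
    [NormedSpace ℝ E] [ProperSpace E] [NormedAddCommGroup G] [NormedSpace ℝ G]
    {g : ℝ → E → G} {g' : ℝ → E → E →L[ℝ] G}
    (hg' : Continuous fun p : ℝ × E => g' p.1 p.2) (hd : ∀ u v, HasFDerivAt (g u) (g' u v) v)
    (a b R : ℝ) :
    ∃ L, ∀ u ∈ Icc a b, ∀ v w : E, ‖v‖ ≤ R → ‖w‖ ≤ R → ‖g u v - g u w‖ ≤ L * ‖v - w‖ := by
  obtain ⟨L, hL⟩ := (isCompact_Icc.prod (isCompact_closedBall (0 : E) R)).exists_bound_of_continuousOn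
    (hg'.continuousOn (s := Icc a b ×ˢ Metric.closedBall (0 : E) R))
  exact ⟨L, fun u hu v w hv hw =>
    (convex_closedBall (0 : E) R).norm_image_sub_le_of_norm_hasFDerivWithin_le
      (fun x _ => (hd u x).hasFDerivWithinAt) (fun x hx => hL (u, x) ⟨hu, hx⟩)
      (by simpa using hw) (by simpa using hv)⟩

/-- **Hadamard's lemma**: the increment of a continuously differentiable map is the average of its
derivative along the segment applied to the increment of the variable. -/
theorem integral_deriv_segment_apply {E G : Type*} [NormedAddCommGroup E] [NormedSpace ℝ E]
    [NormedAddCommGroup G] [NormedSpace ℝ G] [CompleteSpace G]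
    {f : E → G} {f' : E → E →L[ℝ] G} (hf' : Continuous f') (hd : ∀ v, HasFDerivAt f (f' v) v)
    (v w : E) : (∫ θ in (0 : ℝ)..1, f' (v + θ • (w - v))) (w - v) = f w - f v := by
  have hc : Continuous fun θ : ℝ => f' (v + θ • (w - v)) := hf'.comp (by fun_prop)
  rw [ContinuousLinearMap.intervalIntegral_apply (hc.intervalIntegrable _ _)]
  have h : ∀ θ : ℝ, HasDerivAt (fun θ : ℝ => f (v + θ • (w - v)))
      (f' (v + θ • (w - v)) (w - v)) θ := fun θ => by
    refine (hd _).comp_hasDerivAt θ ?_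
    simpa using ((hasDerivAt_id θ).smul_const (w - v)).const_add v
  rw [intervalIntegral.integral_eq_sub_of_hasDerivAt (fun θ _ => h θ)
    ((hc.clm_apply continuous_const).intervalIntegrable _ _)]
  simp

/-- Flows of ODEs with continuously differentiable right-hand side are jointly continuous and
continuously differentiable in the initial value, and the derivative solves the linearized
equation. -/
theorem exists_hasFDerivAt_flow {E : Type*} [NormedAddCommGroup E] [NormedSpace ℝ E]
    [FiniteDimensional ℝ E] {T : ℝ} {g : ℝ → E → E} {g' : ℝ → E → E →L[ℝ] E}
    (hg : Continuous fun p : ℝ × E => g p.1 p.2) (hg' : Continuous fun p : ℝ × E => g' p.1 p.2)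
    (hd : ∀ u v, HasFDerivAt (g u) (g' u v) v) {X : ℝ → ℝ → E → E}
    (hX₀ : ∀ s ∈ Icc 0 T, ∀ x, X s s x = x)
    (hX : ∀ s ∈ Icc 0 T, ∀ x, ∀ t ∈ Icc s T,
      HasDerivWithinAt (fun t => X s t x) (g t (X s t x)) (Icc s T) t) :
    ContinuousOn (fun p : ℝ × ℝ × E => X p.1 p.2.1 p.2.2)
      {p | 0 ≤ p.1 ∧ p.1 ≤ p.2.1 ∧ p.2.1 ≤ T} ∧
    ∃ Φ : ℝ → ℝ → E → E →L[ℝ] E,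
      ContinuousOn (fun p : ℝ × ℝ × E => Φ p.1 p.2.1 p.2.2)
        {p | 0 ≤ p.1 ∧ p.1 ≤ p.2.1 ∧ p.2.1 ≤ T} ∧
      (∀ s ∈ Icc 0 T, ∀ t ∈ Icc s T, ∀ x, HasFDerivAt (fun z => X s t z) (Φ s t x) x) ∧
      (∀ s ∈ Icc 0 T, ∀ x, Φ s s x = ContinuousLinearMap.id ℝ E) ∧
      ∀ s ∈ Icc 0 T, ∀ x, ∀ t ∈ Icc s T, HasDerivWithinAt (fun t => Φ s t x)
        ((g' t (X s t x)).comp (Φ s t x)) (Icc s T) t := by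
  have hXc : ContinuousOn (fun p : ((Icc 0 T) × E) × ℝ => X p.1.1 p.2 p.1.2)
      {p | (p.1.1 : ℝ) ≤ p.2 ∧ p.2 ≤ T} := by
    refine continuousOn_ode_solution (Q := (Icc 0 T) × E) (σ := fun q => q.1)
      (g := fun _ u v => g u v) (Z := fun q t => X q.1 t q.2) (by fun_prop)
      (hg.comp continuous_snd)
      (fun q R => exists_lipschitz_bound_of_continuous_deriv hg' hd q.1 T R) ?_
      (fun q t ht => hX q.1 q.1.2 q.2 t ht)
    exact continuous_snd.congr fun q => (hX₀ q.1 q.1.2 q.2).symm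
  let Y : Icc 0 T → ℝ → E → E := fun s u x => X s (max s (min u T)) x
  have hY : Continuous fun p : (Icc 0 T) × ℝ × E => Y p.1 p.2.1 p.2.2 :=
    hXc.comp_continuous (f := fun p : (Icc 0 T) × ℝ × E =>
      (((p.1, p.2.2), max (p.1 : ℝ) (min p.2.1 T)) : ((Icc 0 T) × E) × ℝ)) (by fun_prop)
      fun p => ⟨le_max_left _ _, max_le p.1.2.2 (min_le_right _ _)⟩
  have hYX : ∀ (s : Icc 0 T) (x : E), ∀ u ∈ Icc (s : ℝ) T, Y s u x = X s u x := fun s x u hu => by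
    simp only [Y, min_eq_left hu.2, max_eq_right hu.1]
  let M : (Icc 0 T) × E × E → ℝ → E →L[ℝ] E := fun q u =>
    ∫ θ in (0 : ℝ)..1, g' u (Y q.1 u q.2.1 + θ • (Y q.1 u q.2.2 - Y q.1 u q.2.1))
  have hM : Continuous fun p : ((Icc 0 T) × E × E) × ℝ => M p.1 p.2 := by
    refine intervalIntegral.continuous_parametric_intervalIntegral_of_continuous'
      (X := ((Icc 0 T) × E × E) × ℝ) (f := fun p θ =>
      g' p.2 (Y p.1.1 p.2 p.1.2.1 + θ • (Y p.1.1 p.2 p.1.2.2 - Y p.1.1 p.2 p.1.2.1))) ?_ 0 1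
    have h1 : Continuous fun z : (((Icc 0 T) × E × E) × ℝ) × ℝ => Y z.1.1.1 z.1.2 z.1.1.2.1 :=
      hY.comp (f := fun z : (((Icc 0 T) × E × E) × ℝ) × ℝ => (z.1.1.1, z.1.2, z.1.1.2.1))
        (by fun_prop)
    have h2 : Continuous fun z : (((Icc 0 T) × E × E) × ℝ) × ℝ => Y z.1.1.1 z.1.2 z.1.1.2.2 :=
      hY.comp (f := fun z : (((Icc 0 T) × E × E) × ℝ) × ℝ => (z.1.1.1, z.1.2, z.1.1.2.2))
        (by fun_prop)
    exact hg'.comp ((continuous_snd.comp continuous_fst).prodMk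
      (h1.add (continuous_snd.smul (h2.sub h1))))
  have hMu : ∀ q, Continuous (M q) := fun q => hM.comp (by fun_prop : Continuous fun u => (q, u))
  choose Ψ hΨ₀ hΨ using fun q : (Icc 0 T) × E × E => exists_hasDerivWithinAt_linear
    (D := fun u => ContinuousLinearMap.compL ℝ E E E (M q u))
    ((ContinuousLinearMap.continuous _).comp (hMu q)) q.1.2.2 (ContinuousLinearMap.id ℝ E)
  simp only [ContinuousLinearMap.compL_apply] at hΨ
  have hΨc : ContinuousOn (fun p : ((Icc 0 T) × E × E) × ℝ => Ψ p.1 p.2)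
      {p | (p.1.1 : ℝ) ≤ p.2 ∧ p.2 ≤ T} := by
    refine continuousOn_ode_solution (Q := (Icc 0 T) × E × E) (σ := fun q => q.1)
      (g := fun q u Φ => (M q u).comp Φ) (by fun_prop) ?_ ?_ ?_ hΨ
    · exact (hM.comp (f := fun z : ((Icc 0 T) × E × E) × ℝ × (E →L[ℝ] E) => (z.1, z.2.1))
        (by fun_prop)).clm_comp (by fun_prop)
    · intro q R
      obtain ⟨L, hL⟩ := isCompact_Icc.exists_bound_of_continuousOn
        ((hMu q).continuousOn (s := Icc (q.1 : ℝ) T))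
      refine ⟨L, fun u hu v w _ _ => ?_⟩
      rw [← ContinuousLinearMap.comp_sub]
      exact (ContinuousLinearMap.opNorm_comp_le _ _).trans (by gcongr; exact hL u hu)
    · exact continuous_const.congr fun q => (hΨ₀ q).symm
  have hΨX : ∀ (s : Icc 0 T) (x y : E), ∀ t ∈ Icc (s : ℝ) T,
      X s t y - X s t x = Ψ (s, x, y) t (y - x) := by
    intro s x y
    obtain ⟨L, hL⟩ := isCompact_Icc.exists_bound_of_continuousOn
      ((hMu (s, x, y)).continuousOn (s := Icc (s : ℝ) T))
    have h1 : ∀ t ∈ Icc (s : ℝ) T, HasDerivWithinAt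
        (fun t => X s t y - X s t x - Ψ (s, x, y) t (y - x))
        (M (s, x, y) t (X s t y - X s t x - Ψ (s, x, y) t (y - x))) (Icc s T) t := by
      intro t ht
      refine (((hX s s.2 y t ht).sub (hX s s.2 x t ht)).sub
        ((hΨ (s, x, y) t ht).clm_apply (hasDerivWithinAt_const _ _ (y - x)))).congr_deriv ?_
      have h2 : M (s, x, y) t (X s t y - X s t x) = g t (X s t y) - g t (X s t x) := by
        simp only [M, hYX s _ t ht]
        exact integral_deriv_segment_apply (hg'.comp (by fun_prop : Continuous fun v => (t, v)))
          (hd t) _ _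
      rw [map_sub (M (s, x, y) t), h2]
      simp
    intro t ht
    refine sub_eq_zero.1 (eq_zero_of_abs_deriv_le_mul_abs_self_of_eq_zero_right (K := L)
      (fun t ht => (h1 t ht).continuousWithinAt)
      (fun t ht => (h1 t (Ico_subset_Icc_self ht)).mono_of_mem_nhdsWithin
        (Icc_mem_nhdsGE_of_mem ht)) ?_
      (fun t ht => (M (s, x, y) t).le_of_opNorm_le (hL t (Ico_subset_Icc_self ht)) _) t ht)
    have := hΨ₀ (s, x, y)
    simp only at this
    simp [hX₀ s s.2, this]
  have hΔ : ∀ {G : Type _} [TopologicalSpace G] {f : (Icc 0 T) → ℝ → E → G},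
      ContinuousOn (fun p : (Icc 0 T) × ℝ × E => f p.1 p.2.1 p.2.2)
        {p | (p.1 : ℝ) ≤ p.2.1 ∧ p.2.1 ≤ T} → ∀ {F : ℝ → ℝ → E → G},
      (∀ s : Icc 0 T, ∀ t x, F s t x = f s t x) →
      ContinuousOn (fun p : ℝ × ℝ × E => F p.1 p.2.1 p.2.2)
        {p | 0 ≤ p.1 ∧ p.1 ≤ p.2.1 ∧ p.2.1 ≤ T} := by
    intro G _ f hf F hF
    rw [continuousOn_iff_continuous_domRestrict]
    refine (hf.comp_continuous (f := fun p : {p : ℝ × ℝ × E | 0 ≤ p.1 ∧ p.1 ≤ p.2.1 ∧ p.2.1 ≤ T} =>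
      ((⟨p.1.1, p.2.1, p.2.2.1.trans p.2.2.2⟩, p.1.2.1, p.1.2.2) : (Icc 0 T) × ℝ × E))
      (by fun_prop) fun p => p.2.2).congr fun p => ?_
    exact (hF ⟨p.1.1, p.2.1, p.2.2.1.trans p.2.2.2⟩ _ _).symm
  refine ⟨hΔ (hXc.comp (f := fun p : (Icc 0 T) × ℝ × E => ((p.1, p.2.2), p.2.1)) (by fun_prop)
    fun p hp => hp) fun _ _ _ => rfl, ?_⟩
  let Φ : ℝ → ℝ → E → E →L[ℝ] E := fun s t x =>
    if hs : s ∈ Icc 0 T then Ψ (⟨s, hs⟩, x, x) t else 0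
  have hΦ : ∀ (s : Icc 0 T) t x, Φ s t x = Ψ (s, x, x) t := fun s t x => by
    simp only [Φ, s.2, dite_true]
  refine ⟨Φ, hΔ (f := fun s t x => Ψ (s, x, x) t) (hΨc.comp
    (f := fun p : (Icc 0 T) × ℝ × E => ((p.1, p.2.2, p.2.2), p.2.1)) (by fun_prop)
    fun p hp => hp) hΦ, fun s hs t ht x => ?_, fun s hs x => ?_, fun s hs x t ht => ?_⟩
  · lift s to Icc 0 T using hs
    rw [hΦ, hasFDerivAt_iff_isLittleO]
    have h1 : Continuous fun y => Ψ (s, x, y) t := hΨc.comp_continuous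
      (f := fun y => (((s, x, y), t) : ((Icc 0 T) × E × E) × ℝ)) (by fun_prop) fun _ => ht
    have h2 : Tendsto (fun y => Ψ (s, x, y) t - Ψ (s, x, x) t) (𝓝 x) (𝓝 0) := by
      simpa using (h1.tendsto x).sub_const (Ψ (s, x, x) t)
    refine Asymptotics.isLittleO_iff.2 fun c hc => ?_
    filter_upwards [Metric.tendsto_nhds.1 h2 c hc] with y hy
    rw [hΨX s x y t ht, ← sub_apply]
    exact ContinuousLinearMap.le_of_opNorm_le _ (by simpa using hy.le) _
  · lift s to Icc 0 T using hs
    rw [hΦ]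
    exact hΨ₀ (s, x, x)
  · lift s to Icc 0 T using hs
    simp only [hΦ]
    have h1 : M (s, x, x) t = g' t (X s t x) := by
      simp [M, hYX s x t ht]
    rw [← h1]
    exact hΨ (s, x, x) t ht

/-- A curve satisfying an integral equation with continuous integrand is differentiable. -/
theorem hasDerivWithinAt_of_eq_add_integral {E : Type*} [NormedAddCommGroup E] [NormedSpace ℝ E]
    [CompleteSpace E] {Z h : ℝ → E} {x : E} {a b : ℝ} (hh : ContinuousOn h (Icc a b))
    (hZ : ∀ t ∈ Icc a b, Z t = x + ∫ u in a..t, h u) {t : ℝ} (ht : t ∈ Icc a b) :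
    HasDerivWithinAt Z (h t) (Icc a b) t := by
  have hab : a ≤ b := ht.1.trans ht.2
  have hc : Continuous (IccExtend hab ((Icc a b).domRestrict h)) := hh.domRestrict.Icc_extend'
  have he : ∀ u ∈ Icc a b, IccExtend hab ((Icc a b).domRestrict h) u = h u := fun u hu => by
    rw [IccExtend_of_mem _ _ hu, domRestrict_apply]
  have hd := ((hc.integral_hasStrictDerivAt a t).hasDerivAt.const_add x).hasDerivWithinAt
    (s := Icc a b)
  rw [he t ht] at hd
  refine hd.congr_of_mem (fun u hu => ?_) ht
  rw [hZ u hu]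
  congr 1
  refine intervalIntegral.integral_congr fun v hv => (he v ?_).symm
  rw [uIcc_of_le hu.1] at hv
  exact ⟨hv.1, hv.2.trans hu.2⟩

/-- Grönwall's inequality for curves in an inner product space whose derivative satisfies a
one-sided bound with time-dependent rate. -/
theorem norm_le_exp_integral_mul_of_inner_deriv_le {H : Type*} [NormedAddCommGroup H]
    [InnerProductSpace ℝ H] {w w' : ℝ → H} {c : ℝ → ℝ} {a b : ℝ} (hc : ContinuousOn c (Icc a b))
    (hw : ∀ t ∈ Icc a b, HasDerivWithinAt w (w' t) (Icc a b) t)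
    (hb : ∀ t ∈ Icc a b, ⟪w' t, w t⟫ ≤ c t * ‖w t‖ ^ 2) {t : ℝ} (ht : t ∈ Icc a b) :
    ‖w t‖ ≤ Real.exp (∫ u in a..t, c u) * ‖w a‖ := by
  have hI : ∀ t ∈ Icc a b, HasDerivWithinAt (fun t => ∫ u in a..t, c u) (c t) (Icc a b) t :=
    fun t ht => hasDerivWithinAt_of_eq_add_integral (x := 0) hc (fun _ _ => (zero_add _).symm) ht
  have hφ : ∀ t ∈ Icc a b, HasDerivWithinAt
      (fun t => Real.exp (-2 * ∫ u in a..t, c u) * ‖w t‖ ^ 2)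
      (2 * Real.exp (-2 * ∫ u in a..t, c u) * (⟪w' t, w t⟫ - c t * ‖w t‖ ^ 2)) (Icc a b) t := by
    intro t ht
    refine (((hI t ht).const_mul (-2)).exp.mul (hw t ht).norm_sq).congr_deriv ?_
    rw [real_inner_comm]
    ring
  have key := image_le_of_deriv_right_le_deriv_boundary
    (B := fun _ => ‖w a‖ ^ 2) (B' := fun _ => 0)
    (fun t ht => (hφ t ht).continuousWithinAt)
    (fun t ht => (hφ t (Ico_subset_Icc_self ht)).mono_of_mem_nhdsWithin
      (Icc_mem_nhdsGE_of_mem ht)) (by simp) continuousOn_const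
    (fun _ _ => hasDerivWithinAt_const _ _ _)
    (fun t ht => mul_nonpos_of_nonneg_of_nonpos (by positivity)
      (sub_nonpos.2 (hb t (Ico_subset_Icc_self ht)))) ht
  refine le_of_sq_le_sq ?_ (by positivity)
  rw [mul_pow, ← Real.exp_nat_mul]
  calc ‖w t‖ ^ 2 = Real.exp (2 * ∫ u in a..t, c u) *
        (Real.exp (-2 * ∫ u in a..t, c u) * ‖w t‖ ^ 2) := by
        rw [← mul_assoc, ← Real.exp_add]; simp
    _ ≤ _ := by push_cast; gcongr

/-- Derivative process estimate: in a non-zero finite-dimensional real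
inner product space `H` with diagonal operator `A` (negative eigenvalues), with
`‖v‖_{H_{1/2}}² = ⟨v, −Av⟩`, `F ∈ C¹(H,H)` satisfying
`⟨F′(x)y, y⟩ ≤ (ε‖x‖_{H_{1/2}}² + C)‖y‖² + ‖y‖_{H_{1/2}}²`, continuous `O : [0,T] → H`,
and flows `𝒳_{s,·}^x` solving `𝒳_{s,t}^x = x + ∫_s^t (A 𝒳_{s,u}^x + F(𝒳_{s,u}^x + O_u)) du`:
(i) `(s,t,x) ↦ 𝒳_{s,t}^x` is `C^{0,0,1}` on `Δ_T × H`; (ii) the derivative satisfies the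
linearized integral equation; and (iii)
`‖∂_x 𝒳_{s,t}^x‖_{L(H)} ≤ exp(∫_s^t (ε‖𝒳_{s,u}^x + O_u‖_{H_{1/2}}² + C) du)`. -/
theorem stmt_8
    {H : Type*} [NormedAddCommGroup H] [InnerProductSpace ℝ H]
    [FiniteDimensional ℝ H] [Nontrivial H]
    {ι : Type*} [Fintype ι] (b : OrthonormalBasis ι ℝ H)
    (lam : ι → ℝ) (hlam : ∀ i, lam i < 0)
    (A : H → H) (hA : ∀ v, A v = ∑ i, (lam i * ⟪b i, v⟫) • b i)
    (T : ℝ) (hT : 0 < T)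
    (ε C : ℝ) (hε : 0 ≤ ε) (hC : 0 ≤ C)
    (F : H → H) (hF : ContDiff ℝ 1 F)
    (hF' : ∀ x y : H,
      ⟪(fderiv ℝ F x) y, y⟫ ≤ (ε * ⟪x, -(A x)⟫ + C) * ‖y‖ ^ 2 + ⟪y, -(A y)⟫)
    (O : ℝ → H) (hO : ContinuousOn O (Set.Icc (0 : ℝ) T))
    (𝒳 : ℝ → ℝ → H → H)
    (h𝒳cont : ∀ s ∈ Set.Icc (0 : ℝ) T, ∀ x : H,
      ContinuousOn (fun t => 𝒳 s t x) (Set.Icc s T))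
    (h𝒳eq : ∀ s ∈ Set.Icc (0 : ℝ) T, ∀ x : H, ∀ t ∈ Set.Icc s T,
      𝒳 s t x = x + ∫ u in s..t, (A (𝒳 s u x) + F (𝒳 s u x + O u))) :
    (ContinuousOn (fun p : ℝ × ℝ × H => 𝒳 p.1 p.2.1 p.2.2)
        {p : ℝ × ℝ × H | 0 ≤ p.1 ∧ p.1 ≤ p.2.1 ∧ p.2.1 ≤ T} ∧
      (∀ s t : ℝ, 0 ≤ s → s ≤ t → t ≤ T → ∀ x : H,
        DifferentiableAt ℝ (fun z => 𝒳 s t z) x) ∧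
      ContinuousOn (fun p : ℝ × ℝ × H => fderiv ℝ (fun z => 𝒳 p.1 p.2.1 z) p.2.2)
        {p : ℝ × ℝ × H | 0 ≤ p.1 ∧ p.1 ≤ p.2.1 ∧ p.2.1 ≤ T}) ∧
    (∀ s ∈ Set.Icc (0 : ℝ) T, ∀ t ∈ Set.Icc s T, ∀ x y : H,
      (fderiv ℝ (fun z => 𝒳 s t z) x) y =
        y + ∫ u in s..t,
          (A ((fderiv ℝ (fun z => 𝒳 s u z) x) y) +
            (fderiv ℝ F (𝒳 s u x + O u)) ((fderiv ℝ (fun z => 𝒳 s u z) x) y))) ∧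
    (∀ s ∈ Set.Icc (0 : ℝ) T, ∀ t ∈ Set.Icc s T, ∀ x : H,
      ‖fderiv ℝ (fun z => 𝒳 s t z) x‖ ≤
        Real.exp (∫ u in s..t,
          (ε * ⟪𝒳 s u x + O u, -(A (𝒳 s u x + O u))⟫ + C))) := by
  obtain ⟨L, hL⟩ : ∃ L : H →L[ℝ] H, ∀ v, A v = L v :=
    ⟨∑ i, lam i • (innerSL ℝ (b i)).smulRight (b i), fun v => by
      simp [hA, mul_smul]⟩
  obtain ⟨U, hUc, hU⟩ : ∃ U : ℝ → H, Continuous U ∧ ∀ u ∈ Icc 0 T, U u = O u :=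
    ⟨IccExtend hT.le ((Icc 0 T).domRestrict O), hO.domRestrict.Icc_extend', fun u hu => by
      rw [IccExtend_of_mem _ _ hu, domRestrict_apply]⟩
  have hsub : ∀ {s}, s ∈ Icc 0 T → Icc s T ⊆ Icc 0 T := fun hs => Icc_subset_Icc_left hs.1
  have hDF : Continuous (fderiv ℝ F) := hF.continuous_fderiv one_ne_zero
  have h𝒳₀ : ∀ s ∈ Icc 0 T, ∀ x, 𝒳 s s x = x := fun s hs x => by
    simpa using h𝒳eq s hs x s (left_mem_Icc.2 hs.2)
  have hzc : ∀ s ∈ Icc 0 T, ∀ x, ContinuousOn (fun u => 𝒳 s u x + O u) (Icc s T) :=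
    fun s hs x => (h𝒳cont s hs x).add (hO.mono (hsub hs))
  obtain ⟨hcont, Φ, hΦc, hΦd, hΦ₀, hΦ⟩ := exists_hasFDerivAt_flow (T := T)
    (g := fun u v => L v + F (v + U u)) (g' := fun u v => L + fderiv ℝ F (v + U u)) (X := 𝒳)
    ((L.continuous.comp continuous_snd).add (hF.continuous.comp (by fun_prop)))
    (continuous_const.add (hDF.comp (by fun_prop)))
    (fun u v => L.hasFDerivAt.add (by
      simpa [Function.comp_def] using ((hF.differentiable one_ne_zero) (v + U u)).hasFDerivAt.comp v
        ((hasFDerivAt_id v).add_const (U u)))) h𝒳₀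
    (fun s hs x t ht => by
      have := hasDerivWithinAt_of_eq_add_integral (Z := fun t => 𝒳 s t x)
        (h := fun u => A (𝒳 s u x) + F (𝒳 s u x + O u)) ?_ (h𝒳eq s hs x) ht
      · simpa only [hL, hU t (hsub hs ht)] using this
      · simp only [hL]
        exact (L.continuous.comp_continuousOn (h𝒳cont s hs x)).add
          (hF.continuous.comp_continuousOn (hzc s hs x)))
  have hfd : ∀ s ∈ Icc 0 T, ∀ t ∈ Icc s T, ∀ x, fderiv ℝ (fun z => 𝒳 s t z) x = Φ s t x :=
    fun s hs t ht x => (hΦd s hs t ht x).fderiv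
  have hlin : ∀ s ∈ Icc 0 T, ∀ x y, ∀ t ∈ Icc s T, HasDerivWithinAt (fun t => Φ s t x y)
      (A (Φ s t x y) + fderiv ℝ F (𝒳 s t x + O t) (Φ s t x y)) (Icc s T) t := by
    intro s hs x y t ht
    refine ((hΦ s hs x t ht).clm_apply (hasDerivWithinAt_const _ _ y)).congr_deriv ?_
    simp [hL, hU t (hsub hs ht)]
  refine ⟨⟨hcont, fun s t h0 hst htT x =>
    (hΦd s ⟨h0, hst.trans htT⟩ t ⟨hst, htT⟩ x).differentiableAt, hΦc.congr fun p hp =>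
      hfd _ ⟨hp.1, hp.2.1.trans hp.2.2⟩ _ hp.2 _⟩, fun s hs t ht x y => ?_, fun s hs t ht x => ?_⟩
  · have hsubt : Icc s t ⊆ Icc s T := Icc_subset_Icc_right ht.2
    have hcΦ : ContinuousOn (fun u => Φ s u x y) (Icc s T) :=
      fun u hu => (hlin s hs x y u hu).continuousWithinAt
    have hint : ContinuousOn (fun u => A (Φ s u x y) +
        fderiv ℝ F (𝒳 s u x + O u) (Φ s u x y)) (Icc s T) := by
      simp only [hL]
      exact (L.continuous.comp_continuousOn hcΦ).add
        ((hDF.comp_continuousOn (hzc s hs x)).clm_apply hcΦ)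
    have hFTC := intervalIntegral.integral_eq_sub_of_hasDeriv_right_of_le ht.1 (hcΦ.mono hsubt)
      (fun u hu => (hlin s hs x y u (hsubt (Ioo_subset_Icc_self hu))).mono_of_mem_nhdsWithin
        (mem_of_superset (Ioo_mem_nhdsGT (hu.2.trans_le ht.2))
          (Ioo_subset_Icc_self.trans (Icc_subset_Icc_left hu.1.le))))
      ((hint.mono hsubt).intervalIntegrable_of_Icc ht.1)
    rw [hfd s hs t ht, intervalIntegral.integral_congr (g := fun u => A (Φ s u x y) +
        fderiv ℝ F (𝒳 s u x + O u) (Φ s u x y)) fun u hu => ?_, hFTC, hΦ₀ s hs]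
    · simp
    · rw [uIcc_of_le ht.1] at hu
      simp only [hfd s hs u (hsubt hu)]
  · rw [hfd s hs t ht]
    refine ContinuousLinearMap.opNorm_le_bound _ (Real.exp_pos _).le fun y => ?_
    have hcc : ContinuousOn
        (fun u => ε * ⟪𝒳 s u x + O u, -(A (𝒳 s u x + O u))⟫ + C) (Icc s T) := by
      simp only [hL]
      exact (continuousOn_const.mul ((hzc s hs x).inner
        (L.continuous.comp_continuousOn (hzc s hs x)).neg)).add continuousOn_const
    have := norm_le_exp_integral_mul_of_inner_deriv_le hcc (hlin s hs x y) (fun u _ => ?_) ht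
    · simpa [hΦ₀ s hs] using this
    · have h := hF' (𝒳 s u x + O u) (Φ s u x y)
      rw [inner_neg_right (Φ s u x y)] at h
      rw [inner_add_left, real_inner_comm (Φ s u x y) (A _)]
      linarith
end
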